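/- arXiv:1406.3078 — 2 statements merged into one kernel-verified Lean document; each statement's English description precedes it below -/
import Mathlib

section
/- Let k be a field of characteristic zero and L a noncommutative Lie k-algebra (i.e., [x,y] ≠ 0 for some x, y ∈ L). Then every division ring D that is a k-algebra and contains the universal enveloping algebra U(L) as a k-subalgebra (i.e., admits an injective k-algebra homomorphism U(L) → D) contains a noncommutative free k-algebra: there exist elements a, b ∈ D generating a free k-algebra on {a, b}. -/
namespace PBW

open scoped WithZero

section Action

variable {k L ι : Type*} [Field k] [LieRing L] [LieAlgebra k L] [LinearOrder ι]

/-- The action of a basis element of `L` on monomials, computed with a bound on the degree. -/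
noncomputable def actAux (b : Module.Basis ι k L) :
    ℕ → ι → (Multiset ι →₀ k) →ₗ[k] (Multiset ι →₀ k)
  | 0, i => Finsupp.linearCombination k fun m => Finsupp.single (i ::ₘ m) 1
  | n + 1, i => Finsupp.linearCombination k fun m =>
      open Classical in
      if m.card ≤ n then actAux b n i (Finsupp.single m 1)
      else if h : ∃ j ∈ m, j < i ∧ ∀ l ∈ m, j ≤ l then
        Finsupp.single (i ::ₘ m) 1
          + actAux b n h.choose (actAux b n i (Finsupp.single (m.erase h.choose) 1)
              - Finsupp.single (i ::ₘ m.erase h.choose) 1)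
          + Finsupp.linearCombination k
              (fun l => actAux b n l (Finsupp.single (m.erase h.choose) 1))
              (b.repr ⁅b i, b h.choose⁆)
      else Finsupp.single (i ::ₘ m) 1

/-- The action of a basis element of `L` on the span of all monomials. -/
noncomputable def act (b : Module.Basis ι k L) (i : ι) :
    (Multiset ι →₀ k) →ₗ[k] (Multiset ι →₀ k) :=
  Finsupp.linearCombination k fun m => actAux b m.card i (Finsupp.single m 1)

/-- The action of an element of `L` on the span of all monomials. -/
noncomputable def actLin (b : Module.Basis ι k L) :
    L →ₗ[k] Module.End k (Multiset ι →₀ k) :=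
  b.constr k (act b)

/-- The span of the monomials of degree at most `n`. -/
noncomputable abbrev degLE (k ι : Type*) [Field k] (n : ℕ) : Submodule k (Multiset ι →₀ k) :=
  Finsupp.supported k k {m | m.card ≤ n}

theorem supported_induction {α : Type*} {s : Set α} {P : (α →₀ k) → Prop} (h0 : P 0)
    (hadd : ∀ p q, P p → P q → P (p + q)) (hsmul : ∀ (c : k) p, P p → P (c • p))
    (h1 : ∀ m ∈ s, P (Finsupp.single m 1)) {p : α →₀ k} (hp : p ∈ Finsupp.supported k k s) :
    P p := by
  rw [Finsupp.supported_eq_span_single] at hp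
  refine Submodule.span_induction ?_ h0 (fun x y _ _ => hadd x y) (fun c x _ => hsmul c x) hp
  rintro _ ⟨m, hm, rfl⟩
  exact h1 m hm

theorem map_mem_of_supported {α M : Type*} [AddCommGroup M] [Module k M] {s : Set α}
    (T : (α →₀ k) →ₗ[k] M) (V : Submodule k M) (h : ∀ m ∈ s, T (Finsupp.single m 1) ∈ V)
    {p : α →₀ k} (hp : p ∈ Finsupp.supported k k s) : T p ∈ V := by
  refine supported_induction (P := fun p => T p ∈ V) (by simp) ?_ ?_ h hp
  · intro p q hp hq
    rw [map_add]
    exact V.add_mem hp hq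
  · intro c p hp
    rw [map_smul]
    exact V.smul_mem c hp

theorem eqOn_supported {α M : Type*} [AddCommGroup M] [Module k M] {s : Set α}
    (T T' : (α →₀ k) →ₗ[k] M)
    (h : ∀ m ∈ s, T (Finsupp.single m 1) = T' (Finsupp.single m 1))
    {p : α →₀ k} (hp : p ∈ Finsupp.supported k k s) : T p = T' p := by
  have := map_mem_of_supported (T - T') ⊥ (s := s) (by simpa [sub_eq_zero] using h) hp
  simpa [sub_eq_zero] using this

theorem linearCombination_mem {α M : Type*} [AddCommGroup M] [Module k M] (V : Submodule k M)
    (g : α → M) (c : α →₀ k) (h : ∀ l ∈ c.support, g l ∈ V) :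
    Finsupp.linearCombination k g c ∈ V := by
  rw [Finsupp.linearCombination_apply]
  exact V.sum_mem fun l hl => V.smul_mem _ (h l hl)

omit [LinearOrder ι] in
theorem single_mem_degLE {m : Multiset ι} {n : ℕ} (h : m.card ≤ n) :
    Finsupp.single m (1 : k) ∈ degLE k ι n :=
  Finsupp.single_mem_supported k _ h

omit [LinearOrder ι] in
theorem degLE_mono {n n' : ℕ} (h : n ≤ n') : degLE k ι n ≤ degLE k ι n' :=
  Finsupp.supported_mono fun _ hm => le_trans hm h

variable (b : Module.Basis ι k L)

theorem actAux_sub_mem (n : ℕ) : ∀ (i : ι) (m : Multiset ι), m.card ≤ n →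
    actAux b n i (Finsupp.single m 1) - Finsupp.single (i ::ₘ m) 1 ∈ degLE k ι m.card := by
  induction n with
  | zero => intro i m _; simp [actAux]
  | succ n ih =>
    have ih' : ∀ (i : ι) {p : Multiset ι →₀ k}, p ∈ degLE k ι n →
        actAux b n i p ∈ degLE k ι (n + 1) := by
      intro i p hp
      refine map_mem_of_supported _ _ (fun m hm => ?_) hp
      have := degLE_mono (le_trans hm n.le_succ) (ih i m hm)
      rw [← sub_add_cancel (actAux b n i (Finsupp.single m 1)) (Finsupp.single (i ::ₘ m) 1)]
      exact Submodule.add_mem _ this (single_mem_degLE (by simpa using hm))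
    intro i m hm
    rw [actAux, Finsupp.linearCombination_single, one_smul]
    split_ifs with h1 h2
    · exact ih i m h1
    · have hcard : m.card = n + 1 := by omega
      have he : (m.erase h2.choose).card = n := by
        rw [Multiset.card_erase_of_mem h2.choose_spec.1, hcard]; rfl
      rw [hcard, add_assoc, add_sub_cancel_left]
      refine Submodule.add_mem _ (ih' _ ?_) (linearCombination_mem _ _ _ fun l _ => ih' _ ?_)
      · simpa [he] using ih i (m.erase h2.choose) he.le
      · exact single_mem_degLE he.le
    · simp

theorem actAux_of_card_le {n : ℕ} {m : Multiset ι} (h : m.card ≤ n) (i : ι) :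
    actAux b n i (Finsupp.single m 1) = act b i (Finsupp.single m 1) := by
  induction n, h using Nat.le_induction with
  | base => simp [act]
  | succ n h ih => rw [← ih, actAux]; simp [h]

theorem actAux_of_mem {n : ℕ} {p : Multiset ι →₀ k} (h : p ∈ degLE k ι n) (i : ι) :
    actAux b n i p = act b i p :=
  eqOn_supported _ _ (fun _ hm => actAux_of_card_le b hm i) h

theorem act_sub_mem (i : ι) (m : Multiset ι) :
    act b i (Finsupp.single m 1) - Finsupp.single (i ::ₘ m) 1 ∈ degLE k ι m.card := by
  rw [← actAux_of_card_le b le_rfl]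
  exact actAux_sub_mem b _ i m le_rfl

theorem act_of_forall_le {i : ι} {m : Multiset ι} (h : ∀ l ∈ m, i ≤ l) :
    act b i (Finsupp.single m 1) = Finsupp.single (i ::ₘ m) 1 := by
  rw [← actAux_of_card_le b le_rfl]
  cases hm : m.card with
  | zero => simp [actAux]
  | succ n =>
    have h2 : ¬ ∃ j ∈ m, j < i ∧ ∀ l ∈ m, j ≤ l := by
      rintro ⟨j, hj, hji, -⟩
      exact (h j hj).not_gt hji
    rw [actAux, Finsupp.linearCombination_single, one_smul, if_neg (by omega), dif_neg h2]

theorem actLin_basis (i : ι) : actLin b (b i) = act b i := by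
  simp [actLin]

theorem actLin_apply (x : L) (p : Multiset ι →₀ k) :
    actLin b x p = Finsupp.linearCombination k (fun l => act b l p) (b.repr x) := by
  rw [actLin, Module.Basis.constr_apply, Finsupp.linearCombination_apply, Finsupp.sum,
    Finsupp.sum, LinearMap.sum_apply]
  rfl

theorem act_cons_of_lt {i j : ι} {m : Multiset ι} (hij : j < i) (h : ∀ l ∈ m, j ≤ l) :
    act b i (act b j (Finsupp.single m 1)) =
      act b j (act b i (Finsupp.single m 1)) + actLin b ⁅b i, b j⁆ (Finsupp.single m 1) := by
  have key : act b i (Finsupp.single (j ::ₘ m) 1) = Finsupp.single (i ::ₘ j ::ₘ m) 1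
      + act b j (act b i (Finsupp.single m 1) - Finsupp.single (i ::ₘ m) 1)
      + actLin b ⁅b i, b j⁆ (Finsupp.single m 1) := by
    have h2 : ∃ j' ∈ j ::ₘ m, j' < i ∧ ∀ l ∈ j ::ₘ m, j' ≤ l :=
      ⟨j, by simp, hij, by simpa using h⟩
    have hj : h2.choose = j := by
      obtain ⟨h3, -, h4⟩ := h2.choose_spec
      refine le_antisymm (h4 j (by simp)) ?_
      rcases Multiset.mem_cons.1 h3 with h5 | h5
      · exact h5.ge
      · exact h _ h5
    rw [← actAux_of_card_le b (n := m.card + 1) (by simp), actAux,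
      Finsupp.linearCombination_single, one_smul, if_neg (by simp), dif_pos h2, hj,
      Multiset.erase_cons_head, actAux_of_card_le b le_rfl,
      actAux_of_mem b (act_sub_mem b i m), actLin_apply]
    simp only [actAux_of_card_le b (le_refl m.card)]
  have h1 : act b j (Finsupp.single (i ::ₘ m) 1) = Finsupp.single (i ::ₘ j ::ₘ m) 1 := by
    rw [act_of_forall_le, Multiset.cons_swap]
    simpa using ⟨hij.le, h⟩
  rw [act_of_forall_le b h, key, map_sub, h1]
  abel

theorem exists_cons_forall_le (m : Multiset ι) (hm : m ≠ 0) :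
    ∃ j m', m = j ::ₘ m' ∧ ∀ l ∈ m', j ≤ l := by
  classical
  obtain ⟨j, hj, hmin⟩ := m.toFinset.exists_min_image id (by
    obtain ⟨a, ha⟩ := Multiset.exists_mem_of_ne_zero hm
    exact ⟨a, by simpa using ha⟩)
  refine ⟨j, m.erase j, (Multiset.cons_erase (by simpa using hj)).symm, fun l hl => ?_⟩
  exact hmin l (by simpa using Multiset.mem_of_mem_erase hl)

theorem act_comm_aux {n : ℕ}
    (ih : ∀ m : Multiset ι, m.card ≤ n → ∀ x y : L,
      actLin b x (actLin b y (Finsupp.single m 1)) - actLin b y (actLin b x (Finsupp.single m 1))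
        = actLin b ⁅x, y⁆ (Finsupp.single m 1))
    {m : Multiset ι} (hm : m.card ≤ n + 1) {i j : ι} (hij : j < i) :
    act b i (act b j (Finsupp.single m 1)) - act b j (act b i (Finsupp.single m 1))
      = actLin b ⁅b i, b j⁆ (Finsupp.single m 1) := by
  by_cases hjm : ∀ l ∈ m, j ≤ l
  · rw [act_cons_of_lt b hij hjm]
    abel
  · have hm0 : m ≠ 0 := by rintro rfl; simp at hjm
    obtain ⟨l, m', rfl, hl⟩ := exists_cons_forall_le m hm0
    have hlj : l < j := by
      by_contra hlj
      refine hjm fun a ha => ?_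
      rcases Multiset.mem_cons.1 ha with rfl | ha
      · exact not_lt.1 hlj
      · exact (not_lt.1 hlj).trans (hl a ha)
    have hm' : m'.card ≤ n := by simpa using hm
    have ihp : ∀ {p : Multiset ι →₀ k}, p ∈ degLE k ι n → ∀ x y : L,
        actLin b x (actLin b y p) - actLin b y (actLin b x p) = actLin b ⁅x, y⁆ p := by
      intro p hp x y
      refine eqOn_supported (actLin b x ∘ₗ actLin b y - actLin b y ∘ₗ actLin b x)
        (actLin b ⁅x, y⁆) (fun m hm => ?_) hp
      simpa using ih m hm x y
    set s : Multiset ι →₀ k := Finsupp.single m' 1 with hs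
    have hcons : Finsupp.single (l ::ₘ m') (1 : k) = act b l s :=
      (act_of_forall_le b hl).symm
    have step : ∀ {i j : ι}, l < i → l < j → act b i (act b j (act b l s)) =
        act b l (act b i (act b j s)) + actLin b ⁅b i, b l⁆ (act b j s)
          + actLin b ⁅b j, b l⁆ (act b i s) + actLin b ⁅b i, ⁅b j, b l⁆⁆ s := by
      intro i j hi hj
      rw [act_cons_of_lt b hj hl, map_add]
      have e1 : act b i (act b l (act b j s)) =
          act b l (act b i (act b j s)) + actLin b ⁅b i, b l⁆ (act b j s) := by
        have hr := act_sub_mem b j m'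
        have h1 := act_cons_of_lt b (m := j ::ₘ m') hi (by simpa using ⟨hj.le, hl⟩)
        have h2 := ihp (degLE_mono hm' hr) (b i) (b l)
        simp only [actLin_basis, map_sub] at h2
        rw [← hs] at h2
        linear_combination (norm := module) h1 + h2
      have e2 := ih m' hm' (b i) ⁅b j, b l⁆
      rw [actLin_basis, ← hs] at e2
      rw [e1, ← e2, ← hs]
      abel
    have hli : l < i := hlj.trans hij
    have e := ih m' hm' (b i) (b j)
    have e' := ih m' hm' ⁅b i, b j⁆ (b l)
    simp only [actLin_basis, ← hs] at e e'
    rw [hcons, step hli hlj, step hlj hli]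
    have jac : ⁅⁅b i, b j⁆, b l⁆ = ⁅b i, ⁅b j, b l⁆⁆ - ⁅b j, ⁅b i, b l⁆⁆ := lie_lie _ _ _
    rw [jac, map_sub, LinearMap.sub_apply] at e'
    have e3 := congrArg (act b l) e
    rw [map_sub] at e3
    linear_combination (norm := module) e3 - e'

omit [LinearOrder ι] in
theorem basis_induction {P : L → Prop} (hb : ∀ i, P (b i)) (h0 : P 0)
    (hadd : ∀ x y, P x → P y → P (x + y)) (hsmul : ∀ (c : k) x, P x → P (c • x)) (x : L) :
    P x := by
  have hx : x ∈ Submodule.span k (Set.range b) := by simp [b.span_eq]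
  refine Submodule.span_induction ?_ h0 (fun x y _ _ => hadd x y) (fun c x _ => hsmul c x) hx
  rintro _ ⟨i, rfl⟩
  exact hb i

theorem actLin_lie_of_basis {p : Multiset ι →₀ k}
    (h : ∀ i j, j < i → act b i (act b j p) - act b j (act b i p) = actLin b ⁅b i, b j⁆ p)
    (x y : L) :
    actLin b x (actLin b y p) - actLin b y (actLin b x p) = actLin b ⁅x, y⁆ p := by
  have hbb : ∀ i j : ι, actLin b (b i) (actLin b (b j) p) - actLin b (b j) (actLin b (b i) p)
      = actLin b ⁅b i, b j⁆ p := by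
    intro i j
    simp only [actLin_basis]
    rcases lt_trichotomy i j with hij | rfl | hij
    · rw [← lie_skew, map_neg, LinearMap.neg_apply, ← h _ _ hij]
      abel
    · simp
    · exact h _ _ hij
  induction x using basis_induction b with
  | h0 => simp
  | hadd x x' hx hx' =>
    simp only [map_add, add_lie, LinearMap.add_apply, ← hx, ← hx']
    abel
  | hsmul c x hx => simp only [map_smul, smul_lie, LinearMap.smul_apply, ← hx, smul_sub]
  | hb i =>
    induction y using basis_induction b with
    | h0 => simp
    | hadd y y' hy hy' =>
      simp only [map_add, lie_add, LinearMap.add_apply, ← hy, ← hy']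
      abel
    | hsmul c y hy => simp only [map_smul, lie_smul, LinearMap.smul_apply, ← hy, smul_sub]
    | hb j => exact hbb i j

theorem actLin_lie_single (n : ℕ) : ∀ m : Multiset ι, m.card ≤ n → ∀ x y : L,
    actLin b x (actLin b y (Finsupp.single m 1)) - actLin b y (actLin b x (Finsupp.single m 1))
      = actLin b ⁅x, y⁆ (Finsupp.single m 1) := by
  induction n with
  | zero =>
    intro m hm x y
    refine actLin_lie_of_basis b (fun i j hij => ?_) x y
    rw [act_cons_of_lt b hij (by simp [Multiset.card_eq_zero.1 (Nat.le_zero.1 hm)])]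
    abel
  | succ n ih =>
    intro m hm x y
    exact actLin_lie_of_basis b (fun i j hij => act_comm_aux b ih hm hij) x y

theorem actLin_lie (x y : L) : actLin b ⁅x, y⁆ =
    actLin b x * actLin b y - actLin b y * actLin b x := by
  ext1 m
  ext1
  simpa using (actLin_lie_single b m.card m le_rfl x y).symm

attribute [local instance] LieRing.ofAssociativeRing

/-- The action of the enveloping algebra on the span of all monomials. -/
noncomputable def rep :
    UniversalEnvelopingAlgebra k L →ₐ[k] Module.End k (Multiset ι →₀ k) :=
  UniversalEnvelopingAlgebra.lift k
    { actLin b with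
      map_lie' := fun {x y} => by
        simpa [LieRing.of_associative_ring_bracket] using actLin_lie b x y }

theorem rep_ι (x : L) : rep b (UniversalEnvelopingAlgebra.ι k x) = actLin b x := by
  rw [rep, UniversalEnvelopingAlgebra.lift_ι_apply]
  rfl

/-- The ordered monomial in the enveloping algebra attached to a multiset of indices. -/
noncomputable def mon (m : Multiset ι) : UniversalEnvelopingAlgebra k L :=
  ((m.sort (· ≤ ·)).map fun i => UniversalEnvelopingAlgebra.ι k (b i)).prod

theorem mon_cons {i : ι} {m : Multiset ι} (h : ∀ l ∈ m, i ≤ l) :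
    mon b (i ::ₘ m) = UniversalEnvelopingAlgebra.ι k (b i) * mon b m := by
  rw [mon, Multiset.sort_cons _ _ _ h]
  simp [mon]

/-- The linear combination of ordered monomials with given coefficients. -/
noncomputable def ofMon : (Multiset ι →₀ k) →ₗ[k] UniversalEnvelopingAlgebra k L :=
  Finsupp.linearCombination k (mon b)

theorem ofMon_single (m : Multiset ι) : ofMon b (Finsupp.single m 1) = mon b m := by
  simp [ofMon]

theorem ι_lie (x y : L) : UniversalEnvelopingAlgebra.ι k ⁅x, y⁆ =
    UniversalEnvelopingAlgebra.ι k x * UniversalEnvelopingAlgebra.ι k y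
      - UniversalEnvelopingAlgebra.ι k y * UniversalEnvelopingAlgebra.ι k x := by
  rw [LieHom.map_lie, LieRing.of_associative_ring_bracket]

theorem ι_mul_ofMon_of_basis {p : Multiset ι →₀ k}
    (h : ∀ i, UniversalEnvelopingAlgebra.ι k (b i) * ofMon b p = ofMon b (act b i p)) (x : L) :
    UniversalEnvelopingAlgebra.ι k x * ofMon b p = ofMon b (actLin b x p) := by
  induction x using basis_induction b with
  | h0 => simp
  | hadd x y hx hy => simp only [map_add, add_mul, hx, hy, LinearMap.add_apply]
  | hsmul c x hx => simp only [map_smul, smul_mul_assoc, hx, LinearMap.smul_apply]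
  | hb i => rw [actLin_basis, h]

theorem ι_mul_ofMon_single (n : ℕ) : ∀ m : Multiset ι, m.card ≤ n → ∀ i : ι,
    UniversalEnvelopingAlgebra.ι k (b i) * ofMon b (Finsupp.single m 1)
      = ofMon b (act b i (Finsupp.single m 1)) := by
  induction n with
  | zero =>
    intro m hm i
    obtain rfl := Multiset.card_eq_zero.1 (Nat.le_zero.1 hm)
    rw [act_of_forall_le b (by simp), ofMon_single, ofMon_single, mon_cons b (by simp)]
  | succ n ih =>
    intro m hm i
    by_cases him : ∀ l ∈ m, i ≤ l
    · rw [act_of_forall_le b him, ofMon_single, ofMon_single, mon_cons b him]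
    · have hm0 : m ≠ 0 := by rintro rfl; simp at him
      obtain ⟨j, m', rfl, hj⟩ := exists_cons_forall_le m hm0
      have hji : j < i := by
        by_contra hji
        refine him fun a ha => ?_
        rcases Multiset.mem_cons.1 ha with rfl | ha
        · exact not_lt.1 hji
        · exact (not_lt.1 hji).trans (hj a ha)
      have hm' : m'.card ≤ n := by simpa using hm
      have ihp : ∀ {p : Multiset ι →₀ k}, p ∈ degLE k ι n → ∀ i : ι,
          UniversalEnvelopingAlgebra.ι k (b i) * ofMon b p = ofMon b (act b i p) := by
        intro p hp i
        exact eqOn_supported (LinearMap.mulLeft k (UniversalEnvelopingAlgebra.ι k (b i)) ∘ₗ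
          ofMon b) (ofMon b ∘ₗ act b i) (fun m hm => ih m hm i) hp
      have e1 := ihp (degLE_mono hm' (act_sub_mem b i m')) j
      have e2 : ofMon b (act b j (Finsupp.single (i ::ₘ m') 1)) =
          UniversalEnvelopingAlgebra.ι k (b j) * ofMon b (Finsupp.single (i ::ₘ m') 1) := by
        have : ∀ l ∈ i ::ₘ m', j ≤ l := by simpa using ⟨hji.le, hj⟩
        rw [act_of_forall_le b this, ofMon_single, ofMon_single, mon_cons b this]
      rw [map_sub, map_sub, mul_sub, map_sub, e2, sub_left_inj] at e1
      have e3 := ι_mul_ofMon_of_basis b (p := Finsupp.single m' 1) (fun i => ih m' hm' i)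
        ⁅b i, b j⁆
      rw [ι_lie, sub_mul, mul_assoc, mul_assoc, ih m' hm', ih m' hm', e1, sub_eq_iff_eq_add,
        act_of_forall_le b hj] at e3
      rw [e3, ← act_of_forall_le b hj, act_cons_of_lt b hji hj, map_add, add_comm]

theorem mkAlgHom_surjective :
    Function.Surjective (UniversalEnvelopingAlgebra.mkAlgHom k L) :=
  RingCon.mkₐ_surjective _

theorem mul_ofMon (u : UniversalEnvelopingAlgebra k L) :
    ∀ p : Multiset ι →₀ k, u * ofMon b p = ofMon b (rep b u p) := by
  obtain ⟨t, rfl⟩ := mkAlgHom_surjective u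
  induction t using TensorAlgebra.induction with
  | algebraMap r =>
    intro p
    rw [AlgHom.commutes, AlgHom.commutes, ← Algebra.smul_def, Module.algebraMap_end_apply,
      map_smul]
  | ι x =>
    intro p
    have h : UniversalEnvelopingAlgebra.mkAlgHom k L (TensorAlgebra.ι k x) =
      UniversalEnvelopingAlgebra.ι k x := rfl
    rw [h, rep_ι]
    refine ι_mul_ofMon_of_basis b (fun i => ?_) x
    exact eqOn_supported (LinearMap.mulLeft k (UniversalEnvelopingAlgebra.ι k (b i)) ∘ₗ
      ofMon b) (ofMon b ∘ₗ act b i) (fun m _ => ι_mul_ofMon_single b m.card m le_rfl i)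
      (s := Set.univ) (by simp)
  | mul t t' ht ht' => intro p; rw [map_mul, map_mul, mul_assoc, ht', ht]; rfl
  | add t t' ht ht' => intro p; rw [map_add, map_add, add_mul, ht', ht, ← map_add]; rfl

/-- The coordinates of an element of the enveloping algebra in the basis of ordered monomials. -/
noncomputable def coord : UniversalEnvelopingAlgebra k L →ₗ[k] (Multiset ι →₀ k) :=
  LinearMap.applyₗ (Finsupp.single 0 1) ∘ₗ (rep b).toLinearMap

theorem coord_apply (u : UniversalEnvelopingAlgebra k L) :
    coord b u = rep b u (Finsupp.single 0 1) := rfl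

theorem ofMon_coord (u : UniversalEnvelopingAlgebra k L) : ofMon b (coord b u) = u := by
  rw [coord_apply, ← mul_ofMon, ofMon_single]
  simp [mon]

theorem coord_mul (u u' : UniversalEnvelopingAlgebra k L) :
    coord b (u * u') = rep b u (coord b u') := by
  simp [coord_apply]

theorem coord_one : coord b 1 = Finsupp.single 0 1 := by
  simp [coord_apply]

theorem coord_eq_zero {u : UniversalEnvelopingAlgebra k L} : coord b u = 0 ↔ u = 0 := by
  refine ⟨fun h => ?_, fun h => by simp [h]⟩
  rw [← ofMon_coord b u, h, map_zero]

theorem coord_ι (i : ι) :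
    coord b (UniversalEnvelopingAlgebra.ι k (b i)) = Finsupp.single {i} 1 := by
  rw [coord_apply, rep_ι, actLin_basis, act_of_forall_le b (by simp)]
  simp

end Action

section Order

variable {k L ι G : Type*} [Field k] [LieRing L] [LieAlgebra k L] [LinearOrder ι]
  [AddCommGroup G] [LinearOrder G] [IsOrderedAddMonoid G]

/-- The span of the monomials of weight less than `g`. -/
noncomputable abbrev wtLT (k : Type*) [Field k] (ν : Multiset ι →+ G) (g : G) :
    Submodule k (Multiset ι →₀ k) :=
  Finsupp.supported k k {m | ν m < g}

omit [LinearOrder ι] [IsOrderedAddMonoid G] in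
theorem wtLT_mono (ν : Multiset ι →+ G) {g g' : G} (h : g ≤ g') : wtLT k ν g ≤ wtLT k ν g' :=
  Finsupp.supported_mono fun _ hm => lt_of_lt_of_le hm h

omit [LinearOrder ι] [IsOrderedAddMonoid G] in
theorem mem_wtLT_of_sub {ν : Multiset ι →+ G} {g : G} {m : Multiset ι} {p : Multiset ι →₀ k}
    (h : p - Finsupp.single m 1 ∈ wtLT k ν (ν m)) (hg : ν m < g) : p ∈ wtLT k ν g := by
  rw [← sub_add_cancel p (Finsupp.single m 1)]
  exact Submodule.add_mem _ (wtLT_mono ν hg.le h) (Finsupp.single_mem_supported k _ hg)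

/-- The largest weight of a monomial occurring in `p`. -/
noncomputable def wt (ν : Multiset ι →+ G) (p : Multiset ι →₀ k) : Gᵐ⁰ :=
  p.support.sup fun m => WithZero.exp (ν m)

omit [LinearOrder ι] [IsOrderedAddMonoid G] in
theorem wt_of_sub_mem {ν : Multiset ι →+ G} {m : Multiset ι} {c : k} (hc : c ≠ 0)
    {p : Multiset ι →₀ k}
    (hp : p - Finsupp.single m c ∈ wtLT k ν (ν m)) : wt ν p = WithZero.exp (ν m) := by
  have hne : ∀ m', m' ≠ m → p m' ≠ 0 → ν m' < ν m := by
    intro m' hm' h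
    refine hp (Finsupp.mem_support_iff.2 ?_)
    simpa [Finsupp.single_apply, hm'.symm] using h
  have hm : p m ≠ 0 := by
    intro h
    have : m ∈ (p - Finsupp.single m c).support := by simp [h, hc]
    exact lt_irrefl _ (hp this)
  refine le_antisymm (Finset.sup_le fun m' hm' => ?_)
    (Finset.le_sup (f := fun m => WithZero.exp (ν m)) (Finsupp.mem_support_iff.2 hm))
  by_cases h : m' = m
  · rw [h]
  · exact WithZero.exp_le_exp.2 (hne m' h (Finsupp.mem_support_iff.1 hm')).le

omit [LinearOrder ι] [IsOrderedAddMonoid G] in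
theorem exists_sub_mem {ν : Multiset ι →+ G} (hinj : Function.Injective ν)
    {p : Multiset ι →₀ k} (hp : p ≠ 0) :
    ∃ m c, c ≠ 0 ∧ p - Finsupp.single m c ∈ wtLT k ν (ν m) := by
  obtain ⟨m, hm, hmax⟩ := p.support.exists_max_image ν (Finsupp.support_nonempty_iff.2 hp)
  refine ⟨m, p m, Finsupp.mem_support_iff.1 hm, fun m' hm' => ?_⟩
  have hne : m' ≠ m := by
    rintro rfl
    simp at hm'
  have : p m' ≠ 0 := by simpa [Finsupp.single_apply, hne.symm] using hm'
  exact lt_of_le_of_ne (hmax m' (Finsupp.mem_support_iff.2 this)) (hinj.ne hne)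

variable (b : Module.Basis ι k L) {ν : Multiset ι →+ G}
  (hν : ∀ i j l, b.repr ⁅b i, b j⁆ l ≠ 0 → ν {l} < ν {i} + ν {j})

include hν

theorem act_sub_mem_wtLT_aux (n : ℕ) : ∀ (i : ι) (m : Multiset ι), m.card ≤ n →
    act b i (Finsupp.single m 1) - Finsupp.single (i ::ₘ m) 1 ∈ wtLT k ν (ν (i ::ₘ m)) := by
  have hcons : ∀ (i : ι) (m : Multiset ι), ν (i ::ₘ m) = ν {i} + ν m := by
    intro i m
    rw [← map_add, Multiset.singleton_add]
  induction n with
  | zero =>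
    intro i m hm
    obtain rfl := Multiset.card_eq_zero.1 (Nat.le_zero.1 hm)
    rw [act_of_forall_le b (by simp), sub_self]
    exact Submodule.zero_mem _
  | succ n ih =>
    intro i m hm
    by_cases him : ∀ l ∈ m, i ≤ l
    · rw [act_of_forall_le b him, sub_self]
      exact Submodule.zero_mem _
    have hm0 : m ≠ 0 := by rintro rfl; simp at him
    obtain ⟨j, m', rfl, hj⟩ := exists_cons_forall_le m hm0
    have hji : j < i := by
      by_contra hji
      refine him fun a ha => ?_
      rcases Multiset.mem_cons.1 ha with rfl | ha
      · exact not_lt.1 hji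
      · exact (not_lt.1 hji).trans (hj a ha)
    have hm' : m'.card ≤ n := by simpa using hm
    have e1 : act b j (Finsupp.single (i ::ₘ m') (1 : k)) =
        Finsupp.single (i ::ₘ j ::ₘ m') 1 := by
      rw [act_of_forall_le b (by simpa using ⟨hji.le, hj⟩), Multiset.cons_swap]
    have e2 := act_cons_of_lt b hji hj
    rw [act_of_forall_le b hj] at e2
    have e3 : act b i (Finsupp.single (j ::ₘ m') 1) - Finsupp.single (i ::ₘ j ::ₘ m') 1 =
        act b j (act b i (Finsupp.single m' 1) - Finsupp.single (i ::ₘ m') 1)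
          + actLin b ⁅b i, b j⁆ (Finsupp.single m' 1) := by
      rw [e2, map_sub, e1]
      abel
    rw [e3]
    refine Submodule.add_mem _ ?_ ?_
    · have hr : act b i (Finsupp.single m' 1) - Finsupp.single (i ::ₘ m') 1 ∈
          Finsupp.supported k k ({m | m.card ≤ n} ∩ {m | ν m < ν (i ::ₘ m')}) := by
        rw [Finsupp.supported_inter]
        exact ⟨degLE_mono hm' (act_sub_mem b i m'), ih i m' hm'⟩
      refine map_mem_of_supported (act b j) _ ?_ hr
      rintro m ⟨hm1, hm2⟩
      refine mem_wtLT_of_sub (ih j m hm1) ?_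
      rw [Set.mem_ofPred_eq, hcons] at hm2
      rw [hcons, hcons, hcons, add_left_comm]
      exact add_lt_add_right hm2 _
    · rw [actLin_apply]
      refine linearCombination_mem _ _ _ fun l hl => mem_wtLT_of_sub (ih l m' hm') ?_
      rw [hcons, hcons, hcons, ← add_assoc]
      exact add_lt_add_left (hν i j l (Finsupp.mem_support_iff.1 hl)) _

theorem act_sub_mem_wtLT (i : ι) (m : Multiset ι) :
    act b i (Finsupp.single m 1) - Finsupp.single (i ::ₘ m) 1 ∈ wtLT k ν (ν (i ::ₘ m)) :=
  act_sub_mem_wtLT_aux b hν _ i m le_rfl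

theorem act_mem_wtLT (i : ι) {g : G} {p : Multiset ι →₀ k} (hp : p ∈ wtLT k ν g) :
    act b i p ∈ wtLT k ν (ν {i} + g) := by
  refine map_mem_of_supported _ _ (fun m hm => ?_) hp
  refine mem_wtLT_of_sub (act_sub_mem_wtLT b hν i m) ?_
  rw [← Multiset.singleton_add, map_add]
  exact add_lt_add_right hm _

theorem rep_mon_sub_mem_aux (n : ℕ) : ∀ (m m' : Multiset ι), m.card = n →
    rep b (mon b m) (Finsupp.single m' 1) - Finsupp.single (m + m') 1 ∈
      wtLT k ν (ν (m + m')) := by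
  induction n with
  | zero =>
    intro m m' hm
    obtain rfl := Multiset.card_eq_zero.1 hm
    simp [mon]
  | succ n ih =>
    intro m m' hm
    have hm0 : m ≠ 0 := by rintro rfl; simp at hm
    obtain ⟨j, m, rfl, hj⟩ := exists_cons_forall_le m hm0
    have h1 := act_mem_wtLT b hν j (ih m m' (by simpa using hm))
    have h2 := act_sub_mem_wtLT b hν j (m + m')
    rw [← map_add, Multiset.singleton_add] at h1
    have h3 := Submodule.add_mem _ h1 h2
    rw [mon_cons b hj, map_mul, Module.End.mul_apply, rep_ι, actLin_basis, Multiset.cons_add]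
    rwa [map_sub, sub_add_sub_cancel] at h3

theorem rep_mon_mem_wtLT {m : Multiset ι} {g : G} {p : Multiset ι →₀ k} (hp : p ∈ wtLT k ν g) :
    rep b (mon b m) p ∈ wtLT k ν (ν m + g) := by
  refine map_mem_of_supported _ _ (fun m' hm => ?_) hp
  refine mem_wtLT_of_sub (rep_mon_sub_mem_aux b hν _ m m' rfl) ?_
  rw [map_add]
  exact add_lt_add_right hm _

theorem rep_sub_mem {u : UniversalEnvelopingAlgebra k L} {m m' : Multiset ι} {c c' : k}
    {p : Multiset ι →₀ k} (hu : coord b u - Finsupp.single m c ∈ wtLT k ν (ν m))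
    (hp : p - Finsupp.single m' c' ∈ wtLT k ν (ν m')) :
    rep b u p - Finsupp.single (m + m') (c * c') ∈ wtLT k ν (ν (m + m')) := by
  have hs : ∀ (m : Multiset ι) (c : k), Finsupp.single m c = c • Finsupp.single m 1 := by simp
  have h1 : ∀ m₁ : Multiset ι, ν m₁ ≤ ν m →
      rep b (mon b m₁) (p - Finsupp.single m' c') ∈ wtLT k ν (ν (m + m')) := fun m₁ hm₁ => by
    refine wtLT_mono ν ?_ (rep_mon_mem_wtLT b hν hp)
    rw [map_add]
    exact add_le_add_left hm₁ _
  have h2 : rep b (ofMon b (coord b u - Finsupp.single m c)) p ∈ wtLT k ν (ν (m + m')) := by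
    refine map_mem_of_supported (LinearMap.applyₗ p ∘ₗ (rep b).toLinearMap ∘ₗ ofMon b) _
      (fun m₁ hm₁ => ?_) hu
    change rep b (ofMon b (Finsupp.single m₁ 1)) p ∈ _
    rw [ofMon_single, ← sub_add_cancel p (Finsupp.single m' c'),
      map_add (rep b (mon b m₁))]
    refine Submodule.add_mem _ (h1 m₁ (le_of_lt hm₁)) ?_
    rw [hs m', map_smul]
    refine Submodule.smul_mem _ _ (mem_wtLT_of_sub (rep_mon_sub_mem_aux b hν _ m₁ m' rfl) ?_)
    rw [map_add, map_add]
    exact add_lt_add_left hm₁ _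
  have h3 := Submodule.smul_mem _ c (h1 m le_rfl)
  have h4 := Submodule.smul_mem _ (c * c') (rep_mon_sub_mem_aux b hν _ m m' rfl)
  have h5 := Submodule.add_mem _ h2 (Submodule.add_mem _ h3 h4)
  rw [map_sub, ofMon_coord, hs m c, map_smul, ofMon_single, map_sub, LinearMap.sub_apply,
    map_smul, LinearMap.smul_apply, map_sub, hs m' c', map_smul] at h5
  rw [hs (m + m')]
  convert h5 using 1
  module


/-- The valuation on the enveloping algebra given by the largest weight of an ordered monomial. -/
noncomputable def valuation (hinj : Function.Injective ν) :
    Valuation (UniversalEnvelopingAlgebra k L) Gᵐ⁰ where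
  toFun u := wt ν (coord b u)
  map_zero' := by simp [wt]
  map_one' := by
    rw [coord_one, wt_of_sub_mem one_ne_zero (m := 0) (by simp), map_zero, WithZero.exp_zero]
  map_mul' u u' := by
    by_cases hu : u = 0
    · simp [hu, wt]
    by_cases hu' : u' = 0
    · simp [hu', wt]
    obtain ⟨m, c, hc, hm⟩ := exists_sub_mem hinj ((coord_eq_zero b).not.2 hu)
    obtain ⟨m', c', hc', hm'⟩ := exists_sub_mem hinj ((coord_eq_zero b).not.2 hu')
    rw [coord_mul, wt_of_sub_mem hc hm, wt_of_sub_mem hc' hm',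
      wt_of_sub_mem (mul_ne_zero hc hc') (rep_sub_mem b hν hm hm'), map_add, WithZero.exp_add]
  map_add_le_max' u u' := by
    classical
    rw [map_add]
    refine (Finset.sup_mono Finsupp.support_add).trans ?_
    rw [Finset.sup_union]
    rfl

theorem valuation_apply (hinj : Function.Injective ν) (u : UniversalEnvelopingAlgebra k L) :
    valuation b hν hinj u = wt ν (coord b u) := rfl

theorem valuation_eq_zero (hinj : Function.Injective ν) {u : UniversalEnvelopingAlgebra k L} :
    valuation b hν hinj u = 0 ↔ u = 0 := by
  refine ⟨fun h => ?_, fun h => by rw [h, map_zero]⟩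
  by_contra hu
  obtain ⟨m, c, hc, hm⟩ := exists_sub_mem hinj ((coord_eq_zero b).not.2 hu)
  rw [valuation_apply, wt_of_sub_mem hc hm] at h
  exact WithZero.exp_ne_zero h

theorem valuation_ι (hinj : Function.Injective ν) (i : ι) :
    valuation b hν hinj (UniversalEnvelopingAlgebra.ι k (b i)) = WithZero.exp (ν {i}) := by
  rw [valuation_apply, coord_ι, wt_of_sub_mem one_ne_zero (m := {i}) (by simp)]

theorem valuation_algebraMap (hinj : Function.Injective ν) {c : k} (hc : c ≠ 0) :
    valuation b hν hinj (algebraMap k _ c) = 1 := by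
  rw [valuation_apply, Algebra.algebraMap_eq_smul_one, map_smul, coord_one, Finsupp.smul_single,
    smul_eq_mul, mul_one, wt_of_sub_mem hc (m := 0) (by simp), map_zero, WithZero.exp_zero]

end Order

end PBW

section FreePair

variable {k A : Type*} [Field k] [Ring A] [Algebra k A]

/-- A linear combination of words in `g 0` and `g 1`, evaluated in `A`. -/
noncomputable def wordEval (k : Type*) [Field k] [Algebra k A] (g : Fin 2 → A) :
    (List (Fin 2) →₀ k) →ₗ[k] A :=
  Finsupp.linearCombination k fun w => (w.map g).prod

theorem freeAlgebra_lift_injective {a b : A}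
    (h : ∀ α : List (Fin 2) →₀ k, wordEval k ![a, b] α = 0 → α = 0) :
    Function.Injective (FreeAlgebra.lift k ![a, b]) := by
  rw [injective_iff_map_eq_zero]
  intro x hx
  set B := FreeAlgebra.basisFreeMonoid k (Fin 2)
  have key : (FreeAlgebra.lift k ![a, b]).toLinearMap ∘ₗ B.repr.symm.toLinearMap
      = wordEval k ![a, b] := by
    refine Finsupp.lhom_ext' fun w => LinearMap.ext_ring ?_
    have hB : B w = FreeAlgebra.equivMonoidAlgebraFreeMonoid.symm (MonoidAlgebra.single w 1) :=
      rfl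
    have he : ∀ w : List (Fin 2),
        wordEval k ![a, b] (Finsupp.single w 1) = (w.map ![a, b]).prod := by
      simp [wordEval]
    refine Eq.trans ?_ (he w).symm
    rw [LinearMap.comp_apply, LinearMap.comp_apply, Finsupp.lsingle_apply, LinearEquiv.coe_coe,
      Module.Basis.repr_symm_single_one, hB]
    change FreeAlgebra.lift k ![a, b] (MonoidAlgebra.lift k _ _ (FreeMonoid.lift _)
      (MonoidAlgebra.single w 1)) = _
    rw [MonoidAlgebra.lift_single, one_smul, FreeMonoid.lift_apply, map_list_prod, List.map_map]
    refine congrArg (fun l : Fin 2 → A => (List.map l w).prod) (funext fun i => ?_)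
    simp
  have h0 := h (B.repr x) <| by
    rw [← key]
    exact (congrArg (FreeAlgebra.lift k ![a, b]) (B.repr.symm_apply_apply x)).trans hx
  exact B.repr.map_eq_zero_iff.1 h0

/-- The words of `α` beginning with `i`, with this letter deleted. -/
noncomputable def dropHead (R : Type*) [CommSemiring R] (i : Fin 2) :
    (List (Fin 2) →₀ R) →ₗ[R] (List (Fin 2) →₀ R) :=
  Finsupp.lcomapDomain (List.cons i) List.cons_injective

theorem dropHead_apply (α : List (Fin 2) →₀ k) (i : Fin 2) (w : List (Fin 2)) :
    dropHead k i α w = α (i :: w) := rfl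

theorem wordEval_eq (g : Fin 2 → A) (α : List (Fin 2) →₀ k) :
    wordEval k g α = α [] • 1 + (g 0 * wordEval k g (dropHead k 0 α)
      + g 1 * wordEval k g (dropHead k 1 α)) := by
  suffices h : wordEval k g = (Finsupp.lapply []).smulRight (1 : A)
      + (LinearMap.mulLeft k (g 0) ∘ₗ wordEval k g ∘ₗ dropHead k 0
      + LinearMap.mulLeft k (g 1) ∘ₗ wordEval k g ∘ₗ dropHead k 1) from DFunLike.congr_fun h α
  refine Finsupp.lhom_ext' fun w => LinearMap.ext_ring ?_
  have hd : ∀ (i j : Fin 2) (w : List (Fin 2)), dropHead k i (Finsupp.single (j :: w) (1 : k))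
      = if j = i then Finsupp.single w 1 else 0 := by
    intro i j w
    ext w'
    rw [dropHead_apply]
    by_cases h : j = i <;> simp [Finsupp.single_apply, h]
  have hd0 : ∀ i : Fin 2, dropHead k i (Finsupp.single [] (1 : k)) = 0 := by
    intro i
    ext w'
    simp [dropHead_apply]
  rcases w with _ | ⟨i, w⟩
  · simp [hd0, wordEval]
  · fin_cases i <;> simp [hd, wordEval]

theorem eq_zero_of_dropHead {α : List (Fin 2) →₀ k} (h : α [] = 0) (h0 : dropHead k 0 α = 0)
    (h1 : dropHead k 1 α = 0) : α = 0 := by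
  ext w
  rcases w with _ | ⟨i, w⟩
  · exact h
  · fin_cases i
    · exact DFunLike.congr_fun h0 w
    · exact DFunLike.congr_fun h1 w

/-- Two elements of a domain without nonzero common right multiples generate a free algebra. -/
theorem freeAlgebra_lift_injective_of_not_ore [NoZeroDivisors A] [Nontrivial A] {u v : A}
    (hu : u ≠ 0) (hv : v ≠ 0) (huv : ∀ s t, u * s = v * t → s = 0) :
    Function.Injective (FreeAlgebra.lift k ![u, v]) := by
  refine freeAlgebra_lift_injective fun α hα => ?_
  obtain ⟨n, hn⟩ : ∃ n, ∀ w, n ≤ w.length → α w = 0 := by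
    refine ⟨α.support.sup List.length + 1, fun w hw => ?_⟩
    by_contra h
    have := Finset.le_sup (f := List.length) (Finsupp.mem_support_iff.2 h)
    omega
  induction n generalizing α with
  | zero =>
    ext w
    exact hn w (Nat.zero_le _)
  | succ n ih =>
    have hn' : ∀ i w, n ≤ w.length → dropHead k i α w = 0 := fun i w hw =>
      hn _ (by simpa using hw)
    rw [wordEval_eq] at hα
    simp only [Matrix.cons_val_zero, Matrix.cons_val_one] at hα
    set p := wordEval k ![u, v] (dropHead k 0 α) with hp
    set q := wordEval k ![u, v] (dropHead k 1 α) with hq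
    obtain ⟨c, hc⟩ : ∃ c : A, c = α [] • 1 := ⟨_, rfl⟩
    have hcomm : ∀ x : A, c * x = x * c := by simp [hc]
    rw [← hc] at hα
    have hc0 : c = 0 := by
      have h1 : c + p * u = 0 := huv _ (-(q * u)) (by
        rw [mul_add, ← hcomm]
        linear_combination (norm := noncomm_ring) hα * u)
      have h2 : q * u = 0 := by
        have h3 : v * (q * u) = 0 := by
          have h4 : u * (c + p * u) = 0 := by rw [h1, mul_zero]
          rw [mul_add, ← hcomm] at h4
          linear_combination (norm := noncomm_ring) hα * u - h4
        exact (mul_eq_zero.1 h3).resolve_left hv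
      have hq0 : q = 0 := (mul_eq_zero.1 h2).resolve_right hu
      rw [hq0, mul_zero, add_zero] at hα
      have h5 : p * v = 0 := huv _ (-c) (by
        rw [mul_neg, ← hcomm]
        linear_combination (norm := noncomm_ring) hα * v)
      have hp0 : p = 0 := (mul_eq_zero.1 h5).resolve_right hv
      simpa [hp0] using hα
    rw [hc0, zero_add] at hα
    have hp0 : p = 0 := huv _ (-q) (by linear_combination (norm := noncomm_ring) hα)
    have hq0 : q = 0 := by
      rw [hp0, mul_zero, zero_add] at hα
      exact (mul_eq_zero.1 hα).resolve_left hv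
    refine eq_zero_of_dropHead ?_ (ih _ hp0 (hn' 0)) (ih _ hq0 (hn' 1))
    rw [hc0] at hc
    simpa using hc.symm

theorem lift_injective_map {B : Type*} [Ring B] [Algebra k B] (f : A →ₐ[k] B)
    (hf : Function.Injective f) {a b : A} (h : Function.Injective (FreeAlgebra.lift k ![a, b])) :
    Function.Injective (FreeAlgebra.lift k ![f a, f b]) := by
  have : FreeAlgebra.lift k ![f a, f b] = f.comp (FreeAlgebra.lift k ![a, b]) := by
    ext i
    fin_cases i <;> simp
  rw [this]
  exact hf.comp h

end FreePair

section Fractions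

universe u

variable {k U : Type*} {D : Type u} [Field k] [Ring U] [Algebra k U] [DivisionRing D] [Algebra k D]

/-- The right fractions with numerator and denominator in the right Ore domain `U`. -/
def fractionSubfield (f : U →+* D) (hf : Function.Injective f)
    (hU : ∀ u v : U, u ≠ 0 → v ≠ 0 → ∃ s t, u * s = v * t ∧ s ≠ 0) : Subfield D where
  carrier := {d | ∃ a b, b ≠ 0 ∧ d * f b = f a}
  zero_mem' := ⟨0, 1, fun h => one_ne_zero (α := D) (by rw [← map_one f, h, map_zero]), by simp⟩
  one_mem' := ⟨1, 1, fun h => one_ne_zero (α := D) (by rw [← map_one f, h, map_zero]), by simp⟩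
  neg_mem' := by
    rintro d ⟨a, b, hb, h⟩
    exact ⟨-a, b, hb, by rw [neg_mul, h, map_neg]⟩
  add_mem' := by
    rintro d d' ⟨a, b, hb, h⟩ ⟨a', b', hb', h'⟩
    obtain ⟨s, t, hst, hs⟩ := hU b b' hb hb'
    have := hf.noZeroDivisors f (map_zero f) (map_mul f)
    refine ⟨a * s + a' * t, b * s, mul_ne_zero hb hs, ?_⟩
    rw [add_mul]
    nth_rw 2 [hst]
    rw [map_add, map_mul, map_mul, map_mul, map_mul, ← mul_assoc, ← mul_assoc, h, h']
  mul_mem' := by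
    rintro d d' ⟨a, b, hb, h⟩ ⟨a', b', hb', h'⟩
    by_cases ha' : a' = 0
    · exact ⟨0, b', hb', by rw [mul_assoc, h', ha', map_zero, mul_zero]⟩
    obtain ⟨s, t, hst, hs⟩ := hU a' b ha' hb
    have := hf.noZeroDivisors f (map_zero f) (map_mul f)
    refine ⟨a * t, b' * s, mul_ne_zero hb' hs, ?_⟩
    rw [map_mul, mul_assoc, ← mul_assoc d', h', ← map_mul, hst, map_mul, ← mul_assoc, h, map_mul]
  inv_mem' := by
    rintro d ⟨a, b, hb, h⟩
    by_cases hd : d = 0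
    · exact ⟨a, b, hb, by rwa [hd, inv_zero, ← hd]⟩
    refine ⟨b, a, ?_, by rw [← h, inv_mul_cancel_left₀ hd]⟩
    rintro rfl
    rw [map_zero, mul_eq_zero, map_eq_zero_iff f hf] at h
    exact h.elim hd hb

theorem exists_divisionRing_of_fractions (f : U →ₐ[k] D) (hf : Function.Injective f)
    (hU : ∀ u v : U, u ≠ 0 → v ≠ 0 → ∃ s t, u * s = v * t ∧ s ≠ 0) :
    ∃ (Q : Type u) (_ : DivisionRing Q) (_ : Algebra k Q) (g : U →ₐ[k] Q) (j : Q →ₐ[k] D),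
      Function.Injective g ∧ Function.Injective j ∧ ∀ d : Q, ∃ a b, b ≠ 0 ∧ d * g b = g a := by
  have h1 : (1 : U) ≠ 0 := fun h => one_ne_zero (α := D) (by rw [← map_one f, h, map_zero])
  let Q := fractionSubfield f.toRingHom hf hU
  have hQ : ∀ u, f u ∈ Q := fun u => ⟨u, 1, h1, by simp⟩
  let : Algebra k Q := ((algebraMap k D).codRestrict Q fun c => by
    rw [← f.commutes]
    exact hQ _).toAlgebra' fun c x => Subtype.ext (Algebra.commutes c (x : D))
  let j : Q →ₐ[k] D := { Q.subtype with commutes' := fun _ => rfl }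
  let g : U →ₐ[k] Q :=
    { f.toRingHom.codRestrict Q hQ with commutes' := fun c => Subtype.ext (f.commutes c) }
  refine ⟨Q, inferInstance, inferInstance, g, j, fun x y h => hf (congrArg Q.subtype h),
    Subtype.val_injective, ?_⟩
  rintro ⟨d, a, b, hb, h⟩
  exact ⟨a, b, hb, Subtype.ext h⟩

theorem exists_valuation_extending {Γ : Type*} [LinearOrderedCommGroupWithZero Γ]
    (f : U →ₐ[k] D) (hf : Function.Injective f)
    (hU : ∀ u v : U, u ≠ 0 → v ≠ 0 → ∃ s t, u * s = v * t ∧ s ≠ 0)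
    (hD : ∀ d : D, ∃ a b, b ≠ 0 ∧ d * f b = f a)
    (v : Valuation U Γ) (hv : ∀ u, v u = 0 → u = 0) :
    ∃ v' : Valuation D Γ, ∀ u, v' (f u) = v u := by
  have h1 : (1 : U) ≠ 0 := fun h => one_ne_zero (α := D) (by rw [← map_one f, h, map_zero])
  have hdom := hf.noZeroDivisors f (map_zero f) (map_mul f)
  have hne : ∀ {u}, u ≠ 0 → v u ≠ 0 := fun hu h => hu (hv _ h)
  choose num den hden hnd using hD
  have key : ∀ d a b, b ≠ 0 → d * f b = f a → v (num d) * (v (den d))⁻¹ = v a * (v b)⁻¹ := by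
    intro d a b hb h
    obtain ⟨s, t, hst, hs⟩ := hU b (den d) hb (hden d)
    have ht : t ≠ 0 := by
      rintro rfl
      rw [mul_zero, mul_eq_zero] at hst
      exact hst.elim hb hs
    have h2 : a * s = num d * t := hf (by
      rw [map_mul, map_mul, ← h, ← hnd, mul_assoc, mul_assoc, ← map_mul, ← map_mul, hst])
    have h3 := congrArg v h2
    have h4 := congrArg v hst
    rw [map_mul, map_mul] at h3 h4
    rw [← div_eq_mul_inv, ← div_eq_mul_inv, div_eq_div_iff (hne (hden d)) (hne hb)]
    refine mul_right_cancel₀ (mul_ne_zero (hne hs) (hne ht)) ?_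
    calc v (num d) * v b * (v s * v t) = (v (num d) * v t) * (v b * v s) := by ac_rfl
      _ = v a * v (den d) * (v s * v t) := by rw [← h3, h4]; ac_rfl
  have hbound : ∀ d c a b, b ≠ 0 → d * f b = f a →
      (v a ≤ c * v b ↔ v (num d) * (v (den d))⁻¹ ≤ c) := by
    intro d c a b hb h
    rw [key d a b hb h, ← div_eq_mul_inv, div_le_iff₀ (zero_lt_iff.2 (hne hb))]
  refine ⟨{ toFun := fun d => v (num d) * (v (den d))⁻¹
            map_zero' := ?_
            map_one' := ?_
            map_mul' := ?_
            map_add_le_max' := ?_ }, fun u => ?_⟩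
  · rw [key 0 0 1 h1 (by simp), map_zero, zero_mul]
  · rw [key 1 1 1 h1 (by simp), map_one, inv_one, mul_one]
  · intro d d'
    by_cases hd' : num d' = 0
    · rw [hd', map_zero, zero_mul, mul_zero, key (d * d') 0 (den d') (hden d') (by
        rw [mul_assoc, hnd, hd', map_zero, mul_zero]), map_zero, zero_mul]
    obtain ⟨s, t, hst, hs⟩ := hU (num d') (den d) hd' (hden d)
    rw [key (d * d') (num d * t) (den d' * s) (mul_ne_zero (hden d') hs) (by
      rw [map_mul, mul_assoc, ← mul_assoc d', hnd, ← map_mul, hst, map_mul, ← mul_assoc, hnd,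
        map_mul])]
    have h4 := congrArg v hst
    rw [map_mul, map_mul] at h4
    rw [map_mul, map_mul, ← div_eq_mul_inv, ← div_eq_mul_inv, ← div_eq_mul_inv, div_mul_div_comm,
      div_eq_div_iff (mul_ne_zero (hne (hden d')) (hne hs))
        (mul_ne_zero (hne (hden d)) (hne (hden d')))]
    calc v (num d) * v t * (v (den d) * v (den d'))
        = v (num d) * (v (den d) * v t) * v (den d') := by ac_rfl
      _ = v (num d) * v (num d') * (v (den d') * v s) := by
        rw [← h4, mul_assoc, mul_assoc, mul_assoc, mul_comm (v s)]
  · intro d d'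
    obtain ⟨s, t, hst, hs⟩ := hU (den d) (den d') (hden d) (hden d')
    have hds : den d * s ≠ 0 := mul_ne_zero (hden d) hs
    have e1 : d * f (den d * s) = f (num d * s) := by
      rw [map_mul, ← mul_assoc, hnd, map_mul]
    have e2 : d' * f (den d * s) = f (num d' * t) := by
      rw [hst, map_mul, ← mul_assoc, hnd, map_mul]
    rw [← hbound (d + d') _ (num d * s + num d' * t) (den d * s) hds (by
      rw [add_mul, e1, e2, map_add])]
    refine (v.map_add _ _).trans (max_le ?_ ?_)
    · exact (hbound d _ _ _ hds e1).2 (le_max_left _ _)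
    · exact (hbound d' _ _ _ hds e2).2 (le_max_right _ _)
  · change v (num (f u)) * (v (den (f u)))⁻¹ = v u
    rw [key (f u) u 1 h1 (by simp), map_one, inv_one, mul_one]

end Fractions

section Polynomials

open Polynomial

variable {k : Type*} [Field k] [CharZero k]

omit [CharZero k] in
theorem exists_isCoprime_factorization {A : k[X]} (hA : A ≠ 0) (B : k[X]) :
    ∃ g A₁ B₁, g ≠ 0 ∧ IsCoprime A₁ B₁ ∧ A = g * A₁ ∧ B = g * B₁ := by
  classical
  let := EuclideanDomain.gcdMonoid k[X]
  obtain ⟨A₁, B₁, hA₁, hB₁, h⟩ := extract_gcd A B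
  refine ⟨GCDMonoid.gcd A B, A₁, B₁, fun h => hA ?_, (gcd_isUnit_iff _ _).1 h, hA₁, hB₁⟩
  rw [hA₁, h, zero_mul]

theorem exists_eq_C_mul_of_wronskian_eq_zero {A B : k[X]} (hA : A ≠ 0)
    (h : wronskian A B = 0) : ∃ c, B = C c * A := by
  obtain ⟨g, A₁, B₁, hg, hcop, rfl, rfl⟩ := exists_isCoprime_factorization hA B
  have h1 : wronskian A₁ B₁ = 0 := by
    have : g ^ 2 * wronskian A₁ B₁ = 0 := by
      rw [← h]
      simp only [wronskian, derivative_mul]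
      ring
    exact (mul_eq_zero.1 this).resolve_left (pow_ne_zero 2 hg)
  obtain ⟨hA', hB'⟩ := (hcop.wronskian_eq_zero_iff).1 h1
  obtain ⟨a, rfl⟩ := natDegree_eq_zero.1 (derivative_eq_zero.1 hA')
  obtain ⟨b, rfl⟩ := natDegree_eq_zero.1 (derivative_eq_zero.1 hB')
  have ha : a ≠ 0 := by
    rintro rfl
    simp at hA
  refine ⟨b / a, ?_⟩
  rw [mul_left_comm, ← C_mul, div_mul_cancel₀ _ ha]

theorem eval_eq_zero_of_wronskian {A B Q ℓ : k[X]} {r : k} (hA : A ≠ 0) (hQ : Q.eval r ≠ 0)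
    (h : (X - C r) * Q * wronskian A B + A ^ 2 * ℓ = 0) : ℓ.eval r = 0 := by
  obtain ⟨g, A₁, B₁, hg, hcop, rfl, rfl⟩ := exists_isCoprime_factorization hA B
  have hA₁ : A₁ ≠ 0 := right_ne_zero_of_mul hA
  have h1 : (X - C r) * Q * wronskian A₁ B₁ + A₁ ^ 2 * ℓ = 0 := by
    have : g ^ 2 * ((X - C r) * Q * wronskian A₁ B₁ + A₁ ^ 2 * ℓ) = 0 := by
      rw [← h]
      simp only [wronskian, derivative_mul]
      ring
    exact (mul_eq_zero.1 this).resolve_left (pow_ne_zero 2 hg)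
  suffices hr : A₁.eval r ≠ 0 by
    have := congrArg (eval r) h1
    simpa [hr] using this
  intro hr
  obtain ⟨A₂, hA₂, hndvd⟩ := exists_eq_pow_rootMultiplicity_mul_and_not_dvd A₁ hA₁ r
  obtain ⟨m, hm⟩ : ∃ m, A₁.rootMultiplicity r = m + 1 :=
    Nat.exists_eq_succ_of_ne_zero ((rootMultiplicity_pos hA₁).2 hr).ne'
  rw [hm] at hA₂
  have hB₁ : B₁.eval r ≠ 0 := by
    obtain ⟨x, y, hxy⟩ := hcop
    intro hB
    have := congrArg (eval r) hxy
    simp [hr, hB] at this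
  have h2 : Q * ((X - C r) * A₂ * derivative B₁ - ((m : k[X]) + 1) * A₂ * B₁
      - (X - C r) * derivative A₂ * B₁) + (X - C r) ^ (m + 1) * A₂ ^ 2 * ℓ = 0 := by
    refine (mul_eq_zero.1 (?_ : (X - C r) ^ (m + 1) * _ = 0)).resolve_left
      (pow_ne_zero _ (X_sub_C_ne_zero r))
    rw [← h1, hA₂]
    simp only [wronskian, derivative_mul, derivative_X_sub_C_pow, Nat.add_sub_cancel]
    push_cast
    rw [C_add, C_1, map_natCast]
    ring
  have h3 := congrArg (eval r) h2
  rw [dvd_iff_isRoot, IsRoot.def] at hndvd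
  have hm0 : (m : k) + 1 ≠ 0 := Nat.cast_add_one_ne_zero m
  simp [hQ, hB₁, hndvd, hm0] at h3

theorem eq_zero_of_X_mul_wronskian {A B : k[X]} {c d : k} (hA : A ≠ 0)
    (h : X * (1 + X) * wronskian A B + A ^ 2 * (C c * (1 + X) + C d) = 0) : c = 0 ∧ d = 0 := by
  have h0 := eval_eq_zero_of_wronskian (r := 0) (Q := 1 + X) hA (by simp) (by simpa using h)
  have h1 := eval_eq_zero_of_wronskian (r := -1) (Q := X) (A := A) (B := B)
    (ℓ := C c * (1 + X) + C d) hA (by simp) (by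
      rw [← h, C_neg, C_1]
      ring)
  simp only [eval_add, eval_mul, eval_C, eval_one, eval_X] at h0 h1
  have hd : d = 0 := by linear_combination h1
  exact ⟨by linear_combination h0 - hd, hd⟩

end Polynomials

section Congruence

open Polynomial

variable {k D Γ : Type*} [Field k] [DivisionRing D] [Algebra k D]
  [LinearOrderedCommGroupWithZero Γ]

/-- Evaluation of a polynomial in two noncommuting elements `s` and `θ`, powers of `s` first. -/
noncomputable def biEval (s θ : D) : k[X][X] →ₗ[k] D :=
  Polynomial.lsum fun j => LinearMap.mulRight k (θ ^ j) ∘ₗ (aeval s).toLinearMap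

theorem biEval_monomial (s θ : D) (j : ℕ) (a : k[X]) :
    biEval s θ (monomial j a) = aeval s a * θ ^ j := by
  simp [biEval, Polynomial.sum_monomial_index]

theorem biEval_C (s θ : D) (a : k[X]) : biEval s θ (C a) = aeval s a := by
  rw [← monomial_zero_left, biEval_monomial, pow_zero, mul_one]

theorem biEval_C_mul (s θ : D) (a : k[X]) (P : k[X][X]) :
    biEval s θ (C a * P) = aeval s a * biEval s θ P := by
  induction P using Polynomial.induction_on' with
  | add p q hp hq => rw [mul_add, map_add, map_add, mul_add, hp, hq]
  | monomial n b => rw [C_mul_monomial, biEval_monomial, biEval_monomial, map_mul, mul_assoc]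

theorem biEval_mul_X (s θ : D) (P : k[X][X]) :
    biEval s θ (P * X) = biEval s θ P * θ := by
  induction P using Polynomial.induction_on' with
  | add p q hp hq => rw [add_mul, map_add, map_add, add_mul, hp, hq]
  | monomial n b => rw [monomial_mul_X, biEval_monomial, biEval_monomial, pow_succ, mul_assoc]

theorem Valuation.map_mul_lt_one_of_le_of_lt (v : Valuation D Γ) {x y : D} (hx : v x ≤ 1)
    (hy : v y < 1) : v (x * y) < 1 := by
  rw [map_mul]
  exact (mul_le_of_le_one_left' hx).trans_lt hy

theorem Valuation.map_mul_lt_one_of_lt_of_le (v : Valuation D Γ) {x y : D} (hx : v x < 1)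
    (hy : v y ≤ 1) : v (x * y) < 1 := by
  rw [map_mul]
  exact (mul_le_of_le_one_right' hy).trans_lt hx

theorem Valuation.map_pow_le_one (v : Valuation D Γ) {x : D} (hx : v x ≤ 1) (n : ℕ) :
    v (x ^ n) ≤ 1 := by
  rw [map_pow]
  exact pow_le_one' hx n

variable (v : Valuation D Γ) (hk : ∀ c : k, v (algebraMap k D c) ≤ 1)

include hk in
theorem map_aeval_le_one {s : D} (hs : v s ≤ 1) (a : k[X]) : v (aeval s a) ≤ 1 := by
  induction a using Polynomial.induction_on' with
  | add p q hp hq =>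
    rw [map_add]
    exact v.map_add_le hp hq
  | monomial n b =>
    rw [aeval_monomial, map_mul, map_pow]
    exact mul_le_one' (hk b) (pow_le_one' hs n)

/-- The elements congruent to some `biEval s θ P * θ` modulo the ideal of the valuation. -/
noncomputable def rightMultiples (s θ : D) : Submodule k D where
  carrier := {x | ∃ P : k[X][X], v (x - biEval s θ P * θ) < 1}
  zero_mem' := ⟨0, by simp⟩
  add_mem' := by
    rintro x y ⟨P, hP⟩ ⟨Q, hQ⟩
    refine ⟨P + Q, ?_⟩
    have : x + y - biEval s θ (P + Q) * θ
        = (x - biEval s θ P * θ) + (y - biEval s θ Q * θ) := by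
      rw [map_add]
      noncomm_ring
    rw [this]
    exact v.map_add_lt hP hQ
  smul_mem' := by
    rintro c x ⟨P, hP⟩
    refine ⟨c • P, ?_⟩
    rw [map_smul, smul_mul_assoc, ← smul_sub, Algebra.smul_def]
    exact v.map_mul_lt_one_of_le_of_lt (hk c) hP

variable {s θ : D}

theorem mem_rightMultiples_of_lt {x : D} (hx : v x < 1) : x ∈ rightMultiples v hk s θ :=
  ⟨0, by simpa using hx⟩

theorem biEval_mul_mem_rightMultiples (P : k[X][X]) :
    biEval s θ P * θ ∈ rightMultiples v hk s θ :=
  ⟨P, by simp⟩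

theorem mem_rightMultiples_of_sub {x y : D} (h : v (x - y) < 1)
    (hy : y ∈ rightMultiples v hk s θ) : x ∈ rightMultiples v hk s θ := by
  rw [← sub_add_cancel x y]
  exact Submodule.add_mem _ (mem_rightMultiples_of_lt v hk h) hy

theorem aeval_mul_mem_rightMultiples (hs : v s ≤ 1) (a : k[X]) {x : D}
    (hx : x ∈ rightMultiples v hk s θ) : aeval s a * x ∈ rightMultiples v hk s θ := by
  obtain ⟨P, hP⟩ := hx
  refine ⟨C a * P, ?_⟩
  rw [biEval_C_mul, mul_assoc, ← mul_sub]
  exact v.map_mul_lt_one_of_le_of_lt (map_aeval_le_one v hk hs a) hP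

theorem aeval_eq_zero_of_mem_rightMultiples
    (hind : ∀ P : k[X][X], v (biEval s θ P) < 1 → P = 0) {a : k[X]}
    (ha : aeval s a ∈ rightMultiples v hk s θ) : a = 0 := by
  obtain ⟨P, hP⟩ := ha
  rw [← biEval_mul_X, ← biEval_C s θ, ← map_sub] at hP
  simpa using congrArg (coeff · 0) (hind _ hP)

theorem map_commutator_pow_lt (hs : v s ≤ 1) (hc : v (θ * s - s * θ - s) < 1) (n : ℕ) :
    v (θ * s ^ n - s ^ n * θ - n * s ^ n) < 1 := by
  induction n with
  | zero => simp
  | succ n ih =>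
    have : θ * s ^ (n + 1) - s ^ (n + 1) * θ - (n + 1 : ℕ) * s ^ (n + 1)
        = (θ * s ^ n - s ^ n * θ - n * s ^ n) * s + s ^ n * (θ * s - s * θ - s) := by
      push_cast
      rw [pow_succ]
      noncomm_ring
    rw [this]
    refine v.map_add_lt ?_ ?_
    · exact v.map_mul_lt_one_of_lt_of_le ih hs
    · exact v.map_mul_lt_one_of_le_of_lt (v.map_pow_le_one hs n) hc

include hk in
theorem map_commutator_aeval_lt (hs : v s ≤ 1) (hc : v (θ * s - s * θ - s) < 1) (a : k[X]) :
    v (θ * aeval s a - aeval s a * θ - aeval s (X * derivative a)) < 1 := by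
  induction a using Polynomial.induction_on' with
  | add p q hp hq =>
    refine lt_of_eq_of_lt (congrArg v ?_) (v.map_add_lt hp hq)
    simp only [map_add, mul_add, add_mul]
    abel
  | monomial n b =>
    have hX : X * derivative (monomial n b) = monomial n (b * n) := by
      rw [derivative_monomial]
      rcases n with _ | n
      · simp
      · rw [X_mul_monomial, Nat.add_sub_cancel]
    have : θ * aeval s (monomial n b) - aeval s (monomial n b) * θ
        - aeval s (X * derivative (monomial n b))
        = algebraMap k D b * (θ * s ^ n - s ^ n * θ - n * s ^ n) := by
      rw [hX, aeval_monomial, aeval_monomial, map_mul, map_natCast, mul_sub, mul_sub,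
        ← mul_assoc, ← Algebra.commutes b θ]
      noncomm_ring
    rw [this]
    exact v.map_mul_lt_one_of_le_of_lt (hk b) (map_commutator_pow_lt v hs hc n)

include hk in
theorem exists_map_mul_biEval_sub_lt (hs : v s ≤ 1) (hθ : v θ ≤ 1)
    (hc : v (θ * s - s * θ - s) < 1) (P : k[X][X]) :
    ∃ Q : k[X][X], v (θ * biEval s θ P - biEval s θ Q) < 1 := by
  induction P using Polynomial.induction_on' with
  | add p q hp hq =>
    obtain ⟨P, hP⟩ := hp
    obtain ⟨Q, hQ⟩ := hq
    refine ⟨P + Q, lt_of_eq_of_lt (congrArg v ?_) (v.map_add_lt hP hQ)⟩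
    simp only [map_add, mul_add]
    abel
  | monomial n b =>
    refine ⟨monomial (n + 1) b + monomial n (X * derivative b), ?_⟩
    have : θ * biEval s θ (monomial n b)
        - biEval s θ (monomial (n + 1) b + monomial n (X * derivative b))
        = (θ * aeval s b - aeval s b * θ - aeval s (X * derivative b)) * θ ^ n := by
      rw [map_add, biEval_monomial, biEval_monomial, biEval_monomial, pow_succ']
      noncomm_ring
    rw [this]
    exact v.map_mul_lt_one_of_lt_of_le (map_commutator_aeval_lt v hk hs hc b)
      (v.map_pow_le_one hθ n)

theorem mul_mem_rightMultiples (hs : v s ≤ 1) (hθ : v θ ≤ 1)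
    (hc : v (θ * s - s * θ - s) < 1) {x : D} (hx : x ∈ rightMultiples v hk s θ) :
    θ * x ∈ rightMultiples v hk s θ := by
  obtain ⟨P, hP⟩ := hx
  obtain ⟨Q, hQ⟩ := exists_map_mul_biEval_sub_lt v hk hs hθ hc P
  refine ⟨Q, ?_⟩
  have : θ * x - biEval s θ Q * θ
      = θ * (x - biEval s θ P * θ) + (θ * biEval s θ P - biEval s θ Q) * θ := by noncomm_ring
  rw [this]
  refine v.map_add_lt ?_ ?_
  · exact v.map_mul_lt_one_of_le_of_lt hθ hP
  · exact v.map_mul_lt_one_of_lt_of_le hQ hθ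

end Congruence

section Criterion

open Polynomial

variable {k D Γ : Type*} [Field k] [DivisionRing D] [Algebra k D]
  [LinearOrderedCommGroupWithZero Γ]

/-- Evaluation of a combination of words with coefficients in `k[X]`, where `X` is sent to `s`. -/
noncomputable def polyWordEval (s : D) (g : Fin 2 → D) : (List (Fin 2) →₀ k[X]) →ₗ[k] D :=
  Finsupp.lsum k fun w => LinearMap.mulRight k (w.map g).prod ∘ₗ (aeval s).toLinearMap

theorem polyWordEval_single (s : D) (g : Fin 2 → D) (w : List (Fin 2)) (a : k[X]) :
    polyWordEval s g (Finsupp.single w a) = aeval s a * (w.map g).prod := by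
  simp [polyWordEval]

theorem polyWordEval_smul (s : D) (g : Fin 2 → D) (a : k[X]) (α : List (Fin 2) →₀ k[X]) :
    polyWordEval s g (a • α) = aeval s a * polyWordEval s g α := by
  induction α using Finsupp.induction_linear with
  | zero => simp
  | add α β hα hβ => rw [smul_add, map_add, map_add, mul_add, hα, hβ]
  | single w b =>
    rw [Finsupp.smul_single, smul_eq_mul, polyWordEval_single, polyWordEval_single, map_mul,
      mul_assoc]

/-- The derivation of words induced by commutation with `(1 + s) * θ`, where a word is
shortened according to `(1 + s) * θ * g 0 = 1 + s` and `(1 + s) * θ * g 1 = 1`. -/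
noncomputable def wordDerivation (α : List (Fin 2) →₀ k[X]) : List (Fin 2) →₀ k[X] :=
  α.mapRange (fun a => X * (1 + X) * derivative a) (by simp)
    + ((1 + X : k[X]) • dropHead k[X] 0 α + dropHead k[X] 1 α)

theorem wordDerivation_apply (α : List (Fin 2) →₀ k[X]) (w : List (Fin 2)) :
    wordDerivation α w = X * (1 + X) * derivative (α w) + ((1 + X) * α (0 :: w) + α (1 :: w)) :=
  rfl

theorem wordDerivation_add (α β : List (Fin 2) →₀ k[X]) :
    wordDerivation (α + β) = wordDerivation α + wordDerivation β := by
  ext1 w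
  simp only [wordDerivation_apply, Finsupp.add_apply, derivative_add]
  ring

theorem wordDerivation_single_nil (a : k[X]) :
    wordDerivation (Finsupp.single [] a) = Finsupp.single [] (X * (1 + X) * derivative a) := by
  ext1 w
  rcases w with _ | ⟨i, w⟩ <;> simp [wordDerivation_apply]

theorem wordDerivation_single_cons (i : Fin 2) (w : List (Fin 2)) (a : k[X]) :
    wordDerivation (Finsupp.single (i :: w) a)
      = Finsupp.single (i :: w) (X * (1 + X) * derivative a)
        + Finsupp.single w (![1 + X, 1] i * a) := by
  ext1 w'
  by_cases h : w = w' <;> by_cases h' : i :: w = w' <;> fin_cases i <;>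
    simp_all [wordDerivation_apply]

variable (v : Valuation D Γ) (hk : ∀ c : k, v (algebraMap k D c) ≤ 1) {s θ : D}

theorem polyWordEval_wordDerivation_mem (hs : v s ≤ 1)
    (hc : v (θ * s - s * θ - s) < 1) {g : Fin 2 → D} (hg : ∀ i, v (g i) ≤ 1)
    (h0 : (1 + s) * θ * g 0 = 1 + s) (h1 : (1 + s) * θ * g 1 = 1) (α : List (Fin 2) →₀ k[X]) :
    polyWordEval s g (wordDerivation α) - (1 + s) * θ * polyWordEval s g α
      ∈ rightMultiples v hk s θ := by
  have hword : ∀ w : List (Fin 2), v (w.map g).prod ≤ 1 := by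
    intro w
    induction w with
    | nil => simp
    | cons i w ih =>
      rw [List.map_cons, List.prod_cons, map_mul]
      exact mul_le_one' (hg i) ih
  have h1s : v (1 + s) ≤ 1 := v.map_add_le (by rw [map_one]) hs
  have hcomm : ∀ (a : k[X]) (w : List (Fin 2)),
      v ((aeval s (X * (1 + X) * derivative a) + aeval s a * ((1 + s) * θ)
        - (1 + s) * θ * aeval s a) * (w.map g).prod) < 1 := by
    intro a w
    refine v.map_mul_lt_one_of_lt_of_le ?_ (hword w)
    have e : (1 + s) * aeval s a = aeval s a * (1 + s) := by
      have : (1 + s) = aeval s (1 + X : k[X]) := by simp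
      rw [this, ← map_mul, ← map_mul, mul_comm]
    have e' : aeval s (X * (1 + X) * derivative a) + aeval s a * ((1 + s) * θ)
        - (1 + s) * θ * aeval s a
        = (1 + s) * -(θ * aeval s a - aeval s a * θ - aeval s (X * derivative a)) := by
      have e₂ : aeval s (X * (1 + X) * derivative a) = (1 + s) * aeval s (X * derivative a) := by
        rw [mul_comm X, mul_assoc, map_mul (aeval s)]
        simp
      rw [e₂, ← mul_assoc (aeval s a), ← e]
      noncomm_ring
    rw [e']
    refine v.map_mul_lt_one_of_le_of_lt h1s ?_
    rw [Valuation.map_neg]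
    exact map_commutator_aeval_lt v hk hs hc a
  induction α using Finsupp.induction_linear with
  | zero =>
    have : wordDerivation (0 : List (Fin 2) →₀ k[X]) = 0 := by
      ext1 w
      simp [wordDerivation_apply]
    simp [this]
  | add α β hα hβ =>
    convert! Submodule.add_mem _ hα hβ using 1
    rw [wordDerivation_add, map_add, map_add, mul_add]
    abel
  | single w a =>
    rcases w with _ | ⟨i, w⟩
    · have hm := aeval_mul_mem_rightMultiples v hk hs (a * (1 + X))
        (biEval_mul_mem_rightMultiples v hk (s := s) (θ := θ) 1)
      refine mem_rightMultiples_of_sub v hk (lt_of_eq_of_lt (congrArg v ?_) (hcomm a []))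
        (Submodule.neg_mem _ hm)
      have : biEval s θ (1 : k[X][X]) = 1 := by
        rw [← C_1, biEval_C, map_one]
      rw [wordDerivation_single_nil, polyWordEval_single, polyWordEval_single, this,
        map_mul (aeval s) a]
      simp only [List.map_nil, List.prod_nil, map_add, map_one, aeval_X]
      noncomm_ring
    · refine mem_rightMultiples_of_lt v hk (lt_of_eq_of_lt (congrArg v ?_) (hcomm a (i :: w)))
      have hi : aeval s (![1 + X, 1] i : k[X]) = (1 + s) * θ * g i := by
        fin_cases i
        · simpa using h0.symm
        · simpa using h1.symm
      rw [wordDerivation_single_cons, map_add, polyWordEval_single, polyWordEval_single,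
        polyWordEval_single, mul_comm _ a, map_mul (aeval s) a, hi]
      simp only [List.map_cons, List.prod_cons]
      noncomm_ring

theorem eq_zero_of_polyWordEval_mem [CharZero k] (hs : v s ≤ 1) (hθ : v θ ≤ 1)
    (hc : v (θ * s - s * θ - s) < 1) {g : Fin 2 → D} (hg : ∀ i, v (g i) ≤ 1)
    (h0 : (1 + s) * θ * g 0 = 1 + s) (h1 : (1 + s) * θ * g 1 = 1)
    (hind : ∀ P : k[X][X], v (biEval s θ P) < 1 → P = 0) (n : ℕ) :
    ∀ α : List (Fin 2) →₀ k[X], (∀ w, n ≤ w.length → α w = 0) →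
      polyWordEval s g α ∈ rightMultiples v hk s θ → α = 0 := by
  induction n with
  | zero =>
    intro α hα _
    ext1 w
    exact hα w (Nat.zero_le _)
  | succ n ih =>
    intro α hα hmem
    obtain ⟨N, hN⟩ : ∃ N, (α.support.filter (List.length · = n)).card = N := ⟨_, rfl⟩
    induction N using Nat.strong_induction_on generalizing α with
    | h N ihN =>
      by_cases htop : ∀ w, w.length = n → α w = 0
      · refine ih α (fun w hw => ?_) hmem
        rcases hw.eq_or_lt with hw | hw
        · exact htop w hw.symm
        · exact hα w hw
      push Not at htop
      obtain ⟨w₀, hw₀, hA⟩ := htop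
      set A := α w₀ with hAdef
      set γ := A • wordDerivation α - (X * (1 + X) * derivative A) • α with hγ
      have hγ_mem : polyWordEval s g γ ∈ rightMultiples v hk s θ := by
        rw [hγ, map_sub, polyWordEval_smul, polyWordEval_smul]
        refine Submodule.sub_mem _ (aeval_mul_mem_rightMultiples v hk hs _ ?_)
          (aeval_mul_mem_rightMultiples v hk hs _ hmem)
        rw [← sub_add_cancel (polyWordEval s g (wordDerivation α))
          ((1 + s) * θ * polyWordEval s g α)]
        refine Submodule.add_mem _
          (polyWordEval_wordDerivation_mem v hk hs hc hg h0 h1 α) ?_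
        rw [mul_assoc]
        have := aeval_mul_mem_rightMultiples v hk hs (1 + X)
          (mul_mem_rightMultiples v hk hs hθ hc hmem)
        simpa using this
      have hγ_apply : ∀ w, γ w = X * (1 + X) * wronskian A (α w)
          + A * ((1 + X) * α (0 :: w) + α (1 :: w)) := by
        intro w
        simp only [hγ, Finsupp.sub_apply, Finsupp.smul_apply, smul_eq_mul, wordDerivation_apply,
          wronskian]
        ring
      have hγ_top : ∀ w, n ≤ w.length → γ w = X * (1 + X) * wronskian A (α w) := by
        intro w hw
        rw [hγ_apply, hα (0 :: w) (by simpa using hw), hα (1 :: w) (by simpa using hw)]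
        ring
      have hγ0 : γ = 0 := by
        refine ihN _ ?_ γ (fun w hw => ?_) hγ_mem rfl
        · rw [← hN]
          refine Finset.card_lt_card ((Finset.ssubset_iff_of_subset fun w hw => ?_).2
            ⟨w₀, by simp [hw₀, ← hAdef, hA], ?_⟩)
          · simp only [Finset.mem_filter, Finsupp.mem_support_iff] at hw ⊢
            refine ⟨fun h => hw.1 ?_, hw.2⟩
            rw [hγ_top w hw.2.ge, h, wronskian_zero_right, mul_zero]
          · simp [hγ_top w₀ hw₀.ge, ← hAdef, wronskian_self_eq_zero]
        · rw [hγ_top w (by omega), hα w hw, wronskian_zero_right, mul_zero]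
      have hX : (X * (1 + X) : k[X]) ≠ 0 := by
        intro h
        have := congrArg (eval 1) h
        norm_num at this
      have htop : ∀ w : List (Fin 2), w.length = n → ∃ c, α w = C c * A := by
        intro w hw
        refine exists_eq_C_mul_of_wronskian_eq_zero hA ?_
        have := hγ_top w hw.ge
        rw [hγ0, Finsupp.zero_apply] at this
        exact (mul_eq_zero.1 this.symm).resolve_left hX
      exfalso
      rcases w₀ with _ | ⟨i, w₁⟩
      · refine hA (aeval_eq_zero_of_mem_rightMultiples v hk hind (s := s) (θ := θ) ?_)
        have : α = Finsupp.single [] A := by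
          ext1 w
          rcases w with _ | ⟨j, w⟩
          · simp [hAdef]
          · rw [hα _ (by rw [← hw₀]; simp)]
            simp
        rw [this, polyWordEval_single] at hmem
        simpa using hmem
      · obtain ⟨c, hc0⟩ := htop (0 :: w₁) hw₀
        obtain ⟨d, hd⟩ := htop (1 :: w₁) hw₀
        have hw₁ := hγ_apply w₁
        rw [hγ0, Finsupp.zero_apply, hc0, hd] at hw₁
        obtain ⟨rfl, rfl⟩ := eq_zero_of_X_mul_wronskian (c := c) (d := d) (B := α w₁) hA (by
          rw [hw₁]
          ring)
        refine hA ?_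
        rw [hAdef]
        fin_cases i
        · simpa using hc0
        · simpa using hd

/-- A division ring with elements `s` and `θ` satisfying `θ * s - s * θ = s` up to lower order
terms contains a free algebra, if `s` and `θ` are sufficiently independent. -/
theorem exists_free_of_commutator [CharZero k] (hs : v s ≤ 1) (hθ : v θ = 1)
    (hc : v (θ * s - s * θ - s) < 1)
    (hind : ∀ P : k[X][X], v (biEval s θ P) < 1 → P = 0)
    (hk : ∀ c : k, v (algebraMap k D c) ≤ 1) :
    ∃ a b : D, Function.Injective (FreeAlgebra.lift k ![a, b]) := by
  have h1s : v (1 + s) = 1 := by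
    refine le_antisymm (v.map_add_le (by rw [map_one]) hs) (not_lt.1 fun h => ?_)
    have h2 := hind (C (1 + X)) (by
      rw [biEval_C]
      simpa using h)
    have := congrArg (fun P => eval 0 (coeff P 0)) h2
    simp at this
  have hθ0 : θ ≠ 0 := by
    rintro rfl
    simp at hθ
  have h1s0 : 1 + s ≠ 0 := by
    intro h
    simp [h] at h1s
  refine ⟨θ⁻¹, ((1 + s) * θ)⁻¹, freeAlgebra_lift_injective fun α hα => ?_⟩
  set g := ![θ⁻¹, ((1 + s) * θ)⁻¹]
  have hmap : ∀ α : List (Fin 2) →₀ k,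
      polyWordEval s g (α.mapRange C C_0) = wordEval k g α := by
    intro α
    induction α using Finsupp.induction_linear with
    | zero => simp
    | add α₁ α₂ h₁ h₂ => rw [Finsupp.mapRange_add (fun _ _ => C_add), map_add, map_add, h₁, h₂]
    | single w c =>
      rw [Finsupp.mapRange_single, polyWordEval_single, wordEval,
        Finsupp.linearCombination_single, aeval_C, Algebra.smul_def]
  set β : List (Fin 2) →₀ k[X] := α.mapRange C C_0 with hβ
  have hβ0 : β = 0 := by
    refine eq_zero_of_polyWordEval_mem v hk hs hθ.le hc (g := g) ?_ ?_ ?_ hind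
      (β.support.sup List.length + 1) β (fun w hw => ?_) ?_
    · intro i
      fin_cases i <;> simp [g, hθ, h1s]
    · simp [g, hθ0]
    · exact mul_inv_cancel₀ (mul_ne_zero h1s0 hθ0)
    · by_contra h
      have := Finset.le_sup (f := List.length) (Finsupp.mem_support_iff.2 h)
      omega
    · rw [hβ, hmap, hα]
      exact Submodule.zero_mem _
  ext w
  simpa [hβ] using DFunLike.congr_fun hβ0 w

end Criterion

section Independence

open Polynomial

variable {k D Γ Γ' : Type*} [Field k] [DivisionRing D] [Algebra k D]
  [LinearOrderedCommGroupWithZero Γ] [LinearOrderedCommGroupWithZero Γ']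

theorem Valuation.exists_map_sum_eq {ι : Type*} (v : Valuation D Γ) (T : Finset ι) (x : ι → D)
    (hx : ∀ i ∈ T, x i ≠ 0) (hT : T.Nonempty) (hinj : Set.InjOn (fun i => v (x i)) T) :
    ∃ i ∈ T, v (∑ j ∈ T, x j) = v (x i) := by
  classical
  obtain ⟨i, hi, hmax⟩ := T.exists_max_image (fun i => v (x i)) hT
  refine ⟨i, hi, ?_⟩
  rw [← Finset.add_sum_erase T x hi]
  refine v.map_add_eq_of_lt_left (v.map_sum_lt (v.ne_zero_iff.2 (hx i hi)) fun j hj => ?_)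
  have hj' := Finset.mem_of_mem_erase hj
  exact lt_of_le_of_ne (hmax j hj') fun h => Finset.ne_of_mem_erase hj (hinj hj' hi h)

theorem biEval_eq_zero_of_lt (v : Valuation D Γ) (h : Γ →*₀ Γ') (hh : Monotone h) {s θ : D}
    (hk : ∀ c : k, c ≠ 0 → v (algebraMap k D c) = 1)
    (hinj : Function.Injective fun q : ℕ × ℕ => v s ^ q.1 * v θ ^ q.2)
    (hs : v.map h hh s = 1) (hθ : v.map h hh θ = 1) (P : k[X][X])
    (hP : v.map h hh (biEval s θ P) < 1) : P = 0 := by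
  by_contra hP0
  have hs0 : s ≠ 0 := by
    rintro rfl
    simp at hs
  have hθ0 : θ ≠ 0 := by
    rintro rfl
    simp at hθ
  let T : Finset (Σ _ : ℕ, ℕ) := P.support.sigma fun j => (P.coeff j).support
  let x : (Σ _ : ℕ, ℕ) → D := fun q =>
    algebraMap k D ((P.coeff q.1).coeff q.2) * s ^ q.2 * θ ^ q.1
  have hc : ∀ q ∈ T, (P.coeff q.1).coeff q.2 ≠ 0 := fun q hq =>
    mem_support_iff.1 (Finset.mem_sigma.1 hq).2
  have hx : ∀ q ∈ T, x q ≠ 0 := fun q hq =>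
    mul_ne_zero (mul_ne_zero ((_root_.map_ne_zero _).2 (hc q hq)) (pow_ne_zero _ hs0))
      (pow_ne_zero _ hθ0)
  have hvx : ∀ q ∈ T, v (x q) = v s ^ q.2 * v θ ^ q.1 := fun q hq => by
    rw [map_mul, map_mul, hk _ (hc q hq), one_mul, map_pow, map_pow]
  have hsum : biEval s θ P = ∑ q ∈ T, x q := by
    rw [Finset.sum_sigma]
    conv_lhs => rw [← P.sum_monomial_eq, Polynomial.sum, map_sum]
    refine Finset.sum_congr rfl fun j _ => ?_
    rw [biEval_monomial, aeval_def, eval₂_eq_sum, Polynomial.sum,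
      Finset.sum_mul]
  have hT : T.Nonempty := by
    obtain ⟨j, hj⟩ := Finset.nonempty_iff_ne_empty.2 (support_eq_empty.not.2 hP0)
    obtain ⟨i, hi⟩ := Finset.nonempty_iff_ne_empty.2
      (support_eq_empty.not.2 (mem_support_iff.1 hj))
    exact ⟨⟨j, i⟩, Finset.mem_sigma.2 ⟨hj, hi⟩⟩
  obtain ⟨q, hq, hv⟩ := v.exists_map_sum_eq T x hx hT fun p hp q hq hpq => by
    simp only [hvx p hp, hvx q hq] at hpq
    have := @hinj (p.2, p.1) (q.2, q.1) hpq
    simp only [Prod.mk.injEq] at this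
    exact Sigma.ext this.2 (heq_of_eq this.1)
  rw [Valuation.map_apply, hsum, hv, hvx q hq, map_mul, map_pow, map_pow] at hP
  rw [Valuation.map_apply] at hs hθ
  rw [hs, hθ, one_pow, one_pow, one_mul] at hP
  exact lt_irrefl _ hP

end Independence

section Weights

open scoped WithZero

/-- The value group recording the weight, the length and the letters of a monomial. -/
abbrev WeightGroup (ι : Type*) := ℤ ×ₗ ℤ ×ₗ Lex (ι →₀ ℤ)

/-- The element of `WeightGroup ι` with given components. -/
def WeightGroup.mk {ι : Type*} (w n : ℤ) (a : ι →₀ ℤ) : WeightGroup ι :=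
  toLex (w, toLex (n, toLex a))

variable {ι : Type*}

theorem WeightGroup.mk_add (w n w' n' : ℤ) (a a' : ι →₀ ℤ) :
    mk (w + w') (n + n') (a + a') = mk w n a + mk w' n' a' := rfl

theorem WeightGroup.mk_sub (w n w' n' : ℤ) (a a' : ι →₀ ℤ) :
    mk (w - w') (n - n') (a - a') = mk w n a - mk w' n' a' := rfl

/-- The weight of an element of `WeightGroup ι`. -/
def WeightGroup.weight : WeightGroup ι →+ ℤ where
  toFun g := (ofLex g).1
  map_zero' := rfl
  map_add' _ _ := rfl

/-- The letters of an element of `WeightGroup ι`, counted with multiplicities. -/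
def WeightGroup.letters : WeightGroup ι →+ (ι →₀ ℤ) where
  toFun g := ofLex (ofLex (ofLex g).2).2
  map_zero' := rfl
  map_add' _ _ := rfl

theorem WeightGroup.weight_mono [LinearOrder ι] : Monotone (weight : WeightGroup ι →+ ℤ) := by
  intro g g' h
  rcases Prod.Lex.le_iff.1 h with h | h
  · exact h.le
  · exact h.1.le

/-- The weight as a homomorphism of the associated groups with zero. -/
noncomputable def WeightGroup.weightHom : (WeightGroup ι)ᵐ⁰ →*₀ ℤᵐ⁰ :=
  WithZero.map' (AddMonoidHom.toMultiplicative weight)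

theorem WeightGroup.weightHom_exp (g : WeightGroup ι) :
    weightHom (WithZero.exp g) = WithZero.exp (weight g) := rfl

theorem WeightGroup.weightHom_mono [LinearOrder ι] :
    Monotone (weightHom : (WeightGroup ι)ᵐ⁰ →*₀ ℤᵐ⁰) :=
  WithZero.map'_mono weight_mono

/-- The value of a monomial whose letters have the weights `w`. -/
noncomputable def WeightGroup.value [DecidableEq ι] (w : ι → ℤ) : Multiset ι →+ WeightGroup ι where
  toFun m := mk (m.map w).sum m.card ((Multiset.toFinsupp m).mapRange Nat.cast Nat.cast_zero)
  map_zero' := by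
    simp
    rfl
  map_add' m m' := by
    rw [Multiset.map_add, Multiset.sum_add, Multiset.card_add, map_add, Nat.cast_add,
      Finsupp.mapRange_add Nat.cast_add, mk_add]

theorem WeightGroup.value_singleton [DecidableEq ι] (w : ι → ℤ) (i : ι) :
    value w {i} = mk (w i) 1 (Finsupp.single i 1) := by
  simp [value]

theorem WeightGroup.value_injective [DecidableEq ι] (w : ι → ℤ) : Function.Injective (value w) := by
  intro m m' h
  have h1 := congrArg letters h
  exact Multiset.toFinsupp.injective
    (Finsupp.mapRange_injective _ Nat.cast_zero Nat.cast_injective h1)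

end Weights

section Existence

open scoped WithZero

open Polynomial UniversalEnvelopingAlgebra

variable {k L D ι : Type*} [Field k] [LieRing L] [LieAlgebra k L] [DivisionRing D] [Algebra k D]
  [LinearOrder ι]

theorem exists_valuation_of_weights (b : Module.Basis ι k L) (w : ι → ℤ)
    (hw : ∀ i j l, b.repr ⁅b i, b j⁆ l ≠ 0 → w l ≤ w i + w j)
    (f : UniversalEnvelopingAlgebra k L →ₐ[k] D) (hf : Function.Injective f)
    (hU : ∀ u v : UniversalEnvelopingAlgebra k L, u ≠ 0 → v ≠ 0 →
      ∃ s t, u * s = v * t ∧ s ≠ 0)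
    (hD : ∀ d : D, ∃ a b, b ≠ 0 ∧ d * f b = f a) :
    ∃ v : Valuation D (WeightGroup ι)ᵐ⁰, (∀ c : k, c ≠ 0 → v (algebraMap k D c) = 1) ∧
      ∀ i, v (f (UniversalEnvelopingAlgebra.ι k (b i)))
        = WithZero.exp (WeightGroup.mk (w i) 1 (Finsupp.single i 1)) := by
  have hν : ∀ i j l, b.repr ⁅b i, b j⁆ l ≠ 0 → WeightGroup.value w {l}
      < WeightGroup.value w {i} + WeightGroup.value w {j} := by
    intro i j l h
    rw [WeightGroup.value_singleton, WeightGroup.value_singleton, WeightGroup.value_singleton,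
      ← WeightGroup.mk_add]
    refine Prod.Lex.lt_iff.2 ?_
    rcases (hw i j l h).lt_or_eq with h | h
    · exact Or.inl h
    · exact Or.inr ⟨h, Prod.Lex.lt_iff.2 (Or.inl (one_lt_two (α := ℤ)))⟩
  have hinj := WeightGroup.value_injective w
  obtain ⟨v, hv⟩ := exists_valuation_extending f hf hU hD (PBW.valuation b hν hinj)
    fun u => (PBW.valuation_eq_zero b hν hinj).1
  refine ⟨v, fun c hc => ?_, fun i => ?_⟩
  · rw [← f.commutes, hv, PBW.valuation_algebraMap b hν hinj hc]
  · rw [hv, PBW.valuation_ι, WeightGroup.value_singleton]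

/-- The criterion `exists_free_of_commutator` for the valuation given by the weights, applied to
two elements of weight zero with linearly independent exponents. -/
theorem exists_free_of_weights [CharZero k] (v : Valuation D (WeightGroup ι)ᵐ⁰)
    (hk : ∀ c : k, c ≠ 0 → v (algebraMap k D c) = 1) {s θ : D} {m n : ℤ} {a b : ι →₀ ℤ}
    (hs : v s = WithZero.exp (WeightGroup.mk 0 m a))
    (hθ : v θ = WithZero.exp (WeightGroup.mk 0 n b))
    (hab : ∀ i j : ℤ, i • a + j • b = 0 → i = 0 ∧ j = 0)
    (hc : v.map WeightGroup.weightHom WeightGroup.weightHom_mono (θ * s - s * θ - s) < 1) :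
    ∃ x y : D, Function.Injective (FreeAlgebra.lift k ![x, y]) := by
  have hs1 : v.map WeightGroup.weightHom WeightGroup.weightHom_mono s = 1 := by
    rw [Valuation.map_apply, hs]
    rfl
  have hθ1 : v.map WeightGroup.weightHom WeightGroup.weightHom_mono θ = 1 := by
    rw [Valuation.map_apply, hθ]
    rfl
  refine exists_free_of_commutator _ hs1.le hθ1 hc
    (biEval_eq_zero_of_lt v _ WeightGroup.weightHom_mono hk ?_ hs1 hθ1) fun c => ?_
  · rintro ⟨i, j⟩ ⟨i', j'⟩ h
    simp only [hs, hθ, ← WithZero.exp_nsmul, ← WithZero.exp_add, WithZero.exp_inj] at h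
    have h1 := congrArg WeightGroup.letters h
    simp only [map_add, map_nsmul] at h1
    have h2 := hab (i - i') (j - j') (by
      change i • a + j • b = i' • a + j' • b at h1
      simp only [← natCast_zsmul] at h1
      linear_combination (norm := module) h1)
    ext <;> dsimp only <;> omega
  · by_cases h : c = 0
    · simp [h]
    · rw [Valuation.map_apply, hk c h, map_one]

end Existence

section Cases

open scoped WithZero

open UniversalEnvelopingAlgebra

universe u

variable {k D : Type*} {L : Type u} [Field k] [LieRing L] [LieAlgebra k L] [DivisionRing D]
  [Algebra k D]

/-- A linearly independent family is part of a basis with linearly ordered index set. -/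
theorem exists_basis_extending {n : ℕ} {e : Fin n → L} (he : LinearIndependent k e) :
    ∃ (ι : Type u) (_ : LinearOrder ι) (b : Module.Basis ι k L) (i : Fin n → ι),
      Function.Injective i ∧ ∀ j, b (i j) = e j := by
  have hs := he.linearIndepOn_id
  refine ⟨hs.extend (Set.subset_univ _), IsWellOrder.linearOrder WellOrderingRel,
    Module.Basis.extend hs, fun j => ⟨e j, hs.subset_extend _ ⟨j, rfl⟩⟩, fun j j' h => ?_,
    fun j => Module.Basis.extend_apply_self hs _⟩
  exact he.injective (congrArg Subtype.val h)

/-- The case of an enveloping algebra of a Lie algebra with elements satisfying `⁅h, s⁆ = s`. -/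
theorem exists_free_of_lie_eq [CharZero k] {h s : L} (hs : s ≠ 0) (hhs : ⁅h, s⁆ = s)
    (f : UniversalEnvelopingAlgebra k L →ₐ[k] D) (hf : Function.Injective f)
    (hU : ∀ u v : UniversalEnvelopingAlgebra k L, u ≠ 0 → v ≠ 0 →
      ∃ s t, u * s = v * t ∧ s ≠ 0)
    (hD : ∀ d : D, ∃ a b, b ≠ 0 ∧ d * f b = f a) :
    ∃ x y : D, Function.Injective (FreeAlgebra.lift k ![x, y]) := by
  have hlin : LinearIndependent k ![h, s] := by
    rw [LinearIndependent.pair_iff]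
    intro c d hcd
    have h1 := congrArg (fun x => ⁅x, s⁆) hcd
    simp only [add_lie, smul_lie, hhs, lie_self, smul_zero, add_zero, zero_lie] at h1
    have hc : c = 0 := (smul_eq_zero.1 h1).resolve_right hs
    rw [hc, zero_smul, zero_add] at hcd
    exact ⟨hc, (smul_eq_zero.1 hcd).resolve_right hs⟩
  obtain ⟨ι, _, b, i, hi, hb⟩ := exists_basis_extending hlin
  obtain ⟨v, hk, hv⟩ := exists_valuation_of_weights b (fun _ => 0) (fun _ _ _ _ => le_rfl)
    f hf hU hD
  have hb0 := hv (i 0)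
  have hb1 := hv (i 1)
  rw [hb] at hb0 hb1
  refine exists_free_of_weights v hk hb1 hb0 (fun m n hmn => ?_) ?_
  · have h01 : i 0 ≠ i 1 := hi.ne (by decide)
    have h0 := DFunLike.congr_fun hmn (i 0)
    have h1 := DFunLike.congr_fun hmn (i 1)
    simp [h01, h01.symm] at h0 h1
    exact ⟨h1, h0⟩
  · have h0 : f (UniversalEnvelopingAlgebra.ι k h) * f (UniversalEnvelopingAlgebra.ι k s)
        - f (UniversalEnvelopingAlgebra.ι k s) * f (UniversalEnvelopingAlgebra.ι k h)
        - f (UniversalEnvelopingAlgebra.ι k s) = 0 := by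
      rw [← map_mul f, ← map_mul f, ← map_sub f, ← PBW.ι_lie, hhs, sub_self]
    change v.map WeightGroup.weightHom WeightGroup.weightHom_mono
      (f (UniversalEnvelopingAlgebra.ι k h) * f (UniversalEnvelopingAlgebra.ι k s)
        - f (UniversalEnvelopingAlgebra.ι k s) * f (UniversalEnvelopingAlgebra.ι k h)
        - f (UniversalEnvelopingAlgebra.ι k s)) < 1
    rw [h0, map_zero]
    exact zero_lt_one

theorem commutator_expansion {R : Type*} [Ring R] {x y z t : R} (hz : z = x * y - y * x)
    (hzt : z * t = 1) :
    x * y * t * (y * y * t) - y * y * t * (x * y * t) - (y * y * t + y * y * t)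
      = x * y * y * (t * y - y * t) * t + x * y * (t * y - y * t) * y * t
        - y * y * x * (t * y - y * t) * t - y * y * (t * x - x * t) * y * t
        + y * (z * y - y * z) * t * t + y * (z * y - y * z) * t * t
        + (z * y - y * z) * y * t * t := by
  have h : y * y * t = y * y * (z * t) * t := by rw [hzt, mul_one]
  have h' : y * y * t + y * y * t = y * y * (z * t) * t + y * y * (z * t) * t := by rw [← h]
  rw [h', hz]
  noncomm_ring

theorem exists_free_of_linearIndependent [CharZero k] {x y : L}
    (hlin : LinearIndependent k ![x, y, ⁅x, y⁆])
    (f : UniversalEnvelopingAlgebra k L →ₐ[k] D) (hf : Function.Injective f)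
    (hU : ∀ u v : UniversalEnvelopingAlgebra k L, u ≠ 0 → v ≠ 0 →
      ∃ s t, u * s = v * t ∧ s ≠ 0)
    (hD : ∀ d : D, ∃ a b, b ≠ 0 ∧ d * f b = f a) :
    ∃ x y : D, Function.Injective (FreeAlgebra.lift k ![x, y]) := by
  obtain ⟨ι, _, b, i, hi, hb⟩ := exists_basis_extending hlin
  have h01 : i 0 ≠ i 1 := hi.ne (by decide)
  have h02 : i 0 ≠ i 2 := hi.ne (by decide)
  have h12 : i 1 ≠ i 2 := hi.ne (by decide)
  let w : ι → ℤ := fun l => if l = i 0 ∨ l = i 1 then 1 else 2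
  have hw1 : ∀ l, 1 ≤ w l := fun l => by
    dsimp only [w]
    split <;> norm_num
  have hw2 : ∀ l, w l ≤ 2 := fun l => by
    dsimp only [w]
    split <;> norm_num
  have hwa : w (i 0) = 1 := by simp [w]
  have hwb : w (i 1) = 1 := by simp [w]
  have hwc : w (i 2) = 2 := by simp [w, h02.symm, h12.symm]
  obtain ⟨v, hk, hv⟩ := exists_valuation_of_weights b w
    (fun l m n _ => by linarith [hw1 l, hw1 m, hw2 n]) f hf hU hD
  let F : L → D := fun l => f (UniversalEnvelopingAlgebra.ι k l)
  have hF : ∀ l m, F ⁅l, m⁆ = F l * F m - F m * F l := fun l m => by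
    simp only [F, PBW.ι_lie, map_sub, map_mul]
  have hx : v (F x) = WithZero.exp (WeightGroup.mk 1 1 (Finsupp.single (i 0) 1)) := by
    have h := hv (i 0)
    rw [hb, hwa] at h
    exact h
  have hy : v (F y) = WithZero.exp (WeightGroup.mk 1 1 (Finsupp.single (i 1) 1)) := by
    have h := hv (i 1)
    rw [hb, hwb] at h
    exact h
  have hz : v (F ⁅x, y⁆) = WithZero.exp (WeightGroup.mk 2 1 (Finsupp.single (i 2) 1)) := by
    have h := hv (i 2)
    rw [hb, hwc] at h
    exact h
  let V := v.map WeightGroup.weightHom WeightGroup.weightHom_mono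
  have hVk : ∀ c : k, V (algebraMap k D c) ≤ 1 := fun c => by
    by_cases h : c = 0
    · simp [h]
    · rw [Valuation.map_apply, hk c h, map_one]
  have hVF : ∀ l, V (F l) ≤ WithZero.exp 2 := fun l => by
    refine PBW.basis_induction (P := fun l => V (F l) ≤ WithZero.exp 2) b (fun j => ?_) ?_ ?_ ?_ l
    · rw [Valuation.map_apply, hv, WeightGroup.weightHom_exp, WithZero.exp_le_exp]
      exact hw2 j
    · simp [F]
    · intro l m hl hm
      simp only [F, map_add]
      exact V.map_add_le hl hm
    · intro c l hl
      have h : F (c • l) = algebraMap k D c * F l := by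
        rw [← Algebra.smul_def, ← map_smul f, ← map_smul (UniversalEnvelopingAlgebra.ι k)]
      rw [h, map_mul]
      exact mul_le_of_le_one_of_le (hVk c) hl
  have hVx : V (F x) = WithZero.exp 1 := by
    rw [Valuation.map_apply, hx]
    rfl
  have hVy : V (F y) = WithZero.exp 1 := by
    rw [Valuation.map_apply, hy]
    rfl
  have hVz : V (F ⁅x, y⁆) = WithZero.exp 2 := by
    rw [Valuation.map_apply, hz]
    rfl
  have hz0 : F ⁅x, y⁆ ≠ 0 := fun h => by
    rw [h, map_zero] at hVz
    exact WithZero.exp_ne_zero hVz.symm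
  set t := (F ⁅x, y⁆)⁻¹ with ht
  have hVt : V t = WithZero.exp (-2) := by
    rw [ht, map_inv₀, hVz, WithZero.exp_neg]
  have hVc : ∀ l, V (t * F l - F l * t) ≤ WithZero.exp (-2) := fun l => by
    have h : t * F l - F l * t = t * F ⁅l, ⁅x, y⁆⁆ * t := by
      rw [hF l, mul_sub, sub_mul, ← mul_assoc, mul_assoc (t * F l), mul_inv_cancel₀ hz0, mul_one,
        ← mul_assoc, inv_mul_cancel₀ hz0, one_mul]
    rw [h, map_mul, map_mul, hVt]
    refine (mul_le_mul_left (mul_le_mul_right (hVF _) _) _).trans ?_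
    rw [← WithZero.exp_add, ← WithZero.exp_add]
    norm_num
  have hVg : V (F ⁅x, y⁆ * F y - F y * F ⁅x, y⁆) ≤ WithZero.exp 2 := by
    rw [← hF]
    exact hVF _
  have hprod : ∀ {a b c d : D} {e : D} {p q r o n : ℤ},
      V a ≤ WithZero.exp p → V b ≤ WithZero.exp q →
      V c ≤ WithZero.exp r → V d ≤ WithZero.exp o → V e ≤ WithZero.exp n → p + q + r + o + n < 0 →
      V (a * b * c * d * e) < 1 := by
    intro a b c d e p q r o n ha hb hc hd he h
    simp only [map_mul]
    refine (mul_le_mul' (mul_le_mul' (mul_le_mul' (mul_le_mul' ha hb) hc) hd) he).trans_lt ?_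
    simp only [← WithZero.exp_add]
    rwa [← WithZero.exp_zero, WithZero.exp_lt_exp]
  have h1 : V 1 ≤ WithZero.exp 0 := by rw [map_one, WithZero.exp_zero]
  let s := F y * F y * t
  let θ := algebraMap k D (1 / 2) * (F x * F y * t)
  have hs : v s = WithZero.exp (WeightGroup.mk 0 1
      (Finsupp.single (i 1) 1 + Finsupp.single (i 1) 1 - Finsupp.single (i 2) 1)) := by
    simp only [s, t, map_mul, map_inv₀, hy, hz, ← WithZero.exp_neg, ← WithZero.exp_add,
      ← sub_eq_add_neg, ← WeightGroup.mk_add, ← WeightGroup.mk_sub]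
    rfl
  have hθ : v θ = WithZero.exp (WeightGroup.mk 0 1
      (Finsupp.single (i 0) 1 + Finsupp.single (i 1) 1 - Finsupp.single (i 2) 1)) := by
    simp only [θ, t, map_mul, map_inv₀, hx, hy, hz, hk (1 / 2) (by norm_num), one_mul,
      ← WithZero.exp_neg, ← WithZero.exp_add,
      ← sub_eq_add_neg, ← WeightGroup.mk_add, ← WeightGroup.mk_sub]
    rfl
  refine exists_free_of_weights v hk hs hθ (fun m n hmn => ?_) ?_
  · have e0 := DFunLike.congr_fun hmn (i 0)
    have e1 := DFunLike.congr_fun hmn (i 1)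
    simp [h01, h01.symm, h02, h12] at e0 e1
    omega
  · have hE : θ * s - s * θ - s = algebraMap k D (1 / 2) *
        (F x * F y * t * (F y * F y * t) - F y * F y * t * (F x * F y * t)
          - (F y * F y * t + F y * F y * t)) := by
      have h2 : s = algebraMap k D (1 / 2) * (s + s) := by
        rw [← two_mul, ← mul_assoc, ← map_ofNat (algebraMap k D) 2, ← map_mul]
        norm_num
      rw [mul_sub, mul_sub, ← h2]
      simp only [θ]
      rw [mul_assoc, ← mul_assoc s, ← Algebra.commutes, mul_assoc _ s]
    rw [hE, commutator_expansion (hF x y) (mul_inv_cancel₀ hz0), map_mul]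
    refine (mul_le_of_le_one_left' (hVk _)).trans_lt ?_
    have hgt : V (F y * (F ⁅x, y⁆ * F y - F y * F ⁅x, y⁆) * t * t) < 1 := by
      simpa using hprod h1 hVy.le hVg hVt.le hVt.le (by norm_num)
    have hgt' : V ((F ⁅x, y⁆ * F y - F y * F ⁅x, y⁆) * F y * t * t) < 1 := by
      simpa using hprod h1 hVg hVy.le hVt.le hVt.le (by norm_num)
    refine V.map_add_lt (V.map_add_lt (V.map_add_lt (V.map_sub_lt (V.map_sub_lt (V.map_add_lt
      ?_ ?_) ?_) ?_) hgt) hgt) hgt'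
    · exact hprod hVx.le hVy.le hVy.le (hVc y) hVt.le (by norm_num)
    · exact hprod hVx.le hVy.le (hVc y) hVy.le hVt.le (by norm_num)
    · exact hprod hVy.le hVy.le hVx.le (hVc y) hVt.le (by norm_num)
    · exact hprod hVy.le hVy.le (hVc x) hVy.le hVt.le (by norm_num)

theorem exists_free_of_lie_ne_zero [CharZero k] {x y : L} (hxy : ⁅x, y⁆ ≠ 0)
    (f : UniversalEnvelopingAlgebra k L →ₐ[k] D) (hf : Function.Injective f)
    (hU : ∀ u v : UniversalEnvelopingAlgebra k L, u ≠ 0 → v ≠ 0 →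
      ∃ s t, u * s = v * t ∧ s ≠ 0)
    (hD : ∀ d : D, ∃ a b, b ≠ 0 ∧ d * f b = f a) :
    ∃ x y : D, Function.Injective (FreeAlgebra.lift k ![x, y]) := by
  by_cases hlin : LinearIndependent k ![x, y, ⁅x, y⁆]
  · exact exists_free_of_linearIndependent hlin f hf hU hD
  have hex : ∃ α β : k, α • x + β • y = ⁅x, y⁆ := by
    rw [Fintype.not_linearIndependent_iff] at hlin
    obtain ⟨g, hg, hg0⟩ := hlin
    simp only [Fin.sum_univ_three, Matrix.cons_val] at hg
    by_cases h2 : g 2 = 0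
    · exfalso
      simp only [h2, zero_smul, add_zero] at hg
      have hx := congrArg (fun l => ⁅l, y⁆) hg
      have hy := congrArg (fun l => ⁅x, l⁆) hg
      simp only [add_lie, smul_lie, lie_self, smul_zero, add_zero, zero_lie, lie_add, lie_smul,
        lie_zero, zero_add, smul_eq_zero, hxy, or_false] at hx hy
      obtain ⟨j, hj⟩ := hg0
      fin_cases j <;> simp_all
    · refine ⟨-(g 2)⁻¹ * g 0, -(g 2)⁻¹ * g 1, ?_⟩
      have h : g 2 • ⁅x, y⁆ = -(g 0 • x + g 1 • y) := by
        linear_combination (norm := module) hg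
      rw [← inv_smul_smul₀ h2 ⁅x, y⁆, h]
      module
  obtain ⟨α, β, h⟩ := hex
  by_cases hα : α = 0
  · have hβ : β ≠ 0 := by
      rintro rfl
      simp [hα, hxy.symm] at h
    refine exists_free_of_lie_eq (h := β⁻¹ • x) (s := y) ?_ ?_ f hf hU hD
    · rintro rfl
      simp at hxy
    · rw [smul_lie, ← h, hα, zero_smul, zero_add, inv_smul_smul₀ hβ]
  · refine exists_free_of_lie_eq (h := -α⁻¹ • y) (s := ⁅x, y⁆) hxy ?_ f hf hU hD
    conv_lhs => rw [← h]
    rw [smul_lie, lie_add, lie_smul, lie_smul, lie_self, smul_zero, add_zero, ← lie_skew x y,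
      neg_smul, inv_smul_smul₀ hα]

end Cases

/-- over a field of characteristic zero, any division ring containing the
universal enveloping algebra of a noncommutative Lie algebra contains a noncommutative
free `k`-algebra of rank two. -/
theorem free_algebra_in_division_ring_containing_enveloping_algebra
    (k : Type*) [Field k] [CharZero k]
    (L : Type*) [LieRing L] [LieAlgebra k L]
    -- `L` is noncommutative
    (hL : ∃ x y : L, ⁅x, y⁆ ≠ 0)
    -- `D` is a division ring containing `U(L)` as a `k`-subalgebra
    (D : Type*) [DivisionRing D] [Algebra k D]
    (f : UniversalEnvelopingAlgebra k L →ₐ[k] D)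
    (hinj : Function.Injective f) :
    ∃ a b : D, Function.Injective ⇑(FreeAlgebra.lift k ![a, b]) := by
  by_contra hD
  have := hinj.noZeroDivisors f (map_zero f) (map_mul f)
  have : Nontrivial (UniversalEnvelopingAlgebra k L) := f.domain_nontrivial
  have hU : ∀ u v : UniversalEnvelopingAlgebra k L, u ≠ 0 → v ≠ 0 →
      ∃ s t, u * s = v * t ∧ s ≠ 0 := by
    intro u v hu hv
    by_contra! h
    exact hD ⟨f u, f v, lift_injective_map f hinj
      (freeAlgebra_lift_injective_of_not_ore hu hv h)⟩
  obtain ⟨Q, _, _, g, j, hg, hj, hQ⟩ := exists_divisionRing_of_fractions f hinj hU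
  obtain ⟨x, y, hxy⟩ := hL
  obtain ⟨a, b, hab⟩ := exists_free_of_lie_ne_zero hxy g hg hU hQ
  exact hD ⟨j a, j b, lift_injective_map j hj hab⟩
end

section
/- Let k be a field, L a Lie k-algebra and L₁ a Lie subalgebra of L. If the universal enveloping algebra U(L) is an Ore domain, then U(L₁) is an Ore domain (where U(L₁) is identified with its image under the canonical injective k-algebra homomorphism U(L₁) → U(L) induced by the inclusion L₁ ⊆ L). -/
namespace RelativePBW

open Module Finsupp

noncomputable section

attribute [local instance] LieRing.ofAssociativeRing

variable {k L X Y W : Type*} [Field k] [LieRing L] [LieAlgebra k L] [LinearOrder X]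
  [AddCommGroup W] [Module k W]

section Extension

variable (b : Basis (X ⊕ Y) k L)

/-- The bilinear action of `L` on `Multiset X →₀ W` prescribed on basis elements. -/
def bilinExt (g : X ⊕ Y → Multiset X → W →ₗ[k] (Multiset X →₀ W)) :
    L →ₗ[k] End k (Multiset X →₀ W) :=
  b.constr k fun a => Finsupp.lsum k (g a)

omit [LinearOrder X] in
@[simp]
lemma bilinExt_basis_single (g : X ⊕ Y → Multiset X → W →ₗ[k] (Multiset X →₀ W))
    (a : X ⊕ Y) (J : Multiset X) (w : W) : bilinExt b g (b a) (single J w) = g a J w := by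
  simp [bilinExt, Basis.constr_basis]

variable (k X W) in
/-- The filtration of `Multiset X →₀ W` by cardinality. -/
def filt (n : ℕ) : Submodule k (Multiset X →₀ W) := supported W k {J | J.card ≤ n}

omit [LinearOrder X] in
lemma single_mem_filt {J : Multiset X} {n : ℕ} (h : J.card ≤ n) (w : W) :
    single J w ∈ filt k X W n :=
  single_mem_supported k w h

omit [LinearOrder X] in
lemma filt_mono {m n : ℕ} (h : m ≤ n) : filt k X W m ≤ filt k X W n :=
  supported_mono fun _ hJ => le_trans hJ h

omit [LinearOrder X] in
/-- A linear property of elements of the filtration can be checked on generators. -/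
lemma filt_induction {n : ℕ} {S : Submodule k (Multiset X →₀ W)}
    (h : ∀ J : Multiset X, J.card ≤ n → ∀ w, single J w ∈ S) : filt k X W n ≤ S := by
  intro v hv
  rw [← v.sum_single]
  exact S.sum_mem fun J hJ => h J (hv hJ) _

omit [LinearOrder X] in
lemma basis_induction {S : Submodule k L} (h : ∀ a, b a ∈ S) (l : L) : l ∈ S := by
  have : (⊤ : Submodule k L) ≤ S := by
    rw [← b.span_eq, Submodule.span_le]
    rintro _ ⟨a, rfl⟩
    exact h a
  exact this trivial

omit [LinearOrder X] in
lemma bilinExt_congr {g g' : X ⊕ Y → Multiset X → W →ₗ[k] (Multiset X →₀ W)} {n : ℕ}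
    (h : ∀ a J, Multiset.card J ≤ n → g a J = g' a J) (l : L) {v : Multiset X →₀ W}
    (hv : v ∈ filt k X W n) : bilinExt b g l v = bilinExt b g' l v := by
  refine basis_induction b (S := LinearMap.eqLocus ((bilinExt b g).flip v)
    ((bilinExt b g').flip v)) (fun a => ?_) l
  refine filt_induction (S := LinearMap.eqLocus (bilinExt b g (b a)) (bilinExt b g' (b a)))
    (fun J hJ w => ?_) hv
  simp [LinearMap.mem_eqLocus, h a J hJ]

variable (k) in
/-- The leading term of the action of a basis element on a monomial. -/
def lead : X ⊕ Y → Multiset X → W →ₗ[k] (Multiset X →₀ W)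
  | .inl x, J => lsingle (x ::ₘ J)
  | .inr _, _ => 0

omit [LinearOrder X] in
lemma lead_mem_filt (a : X ⊕ Y) (J : Multiset X) (w : W) :
    lead k a J w ∈ filt k X W (J.card + 1) := by
  cases a with
  | inl x => exact single_mem_filt (by simp) w
  | inr y => exact Submodule.zero_mem _

omit [LinearOrder X] in
lemma bilinExt_mem_filt {g : X ⊕ Y → Multiset X → W →ₗ[k] (Multiset X →₀ W)} {n : ℕ}
    (h : ∀ a J, Multiset.card J ≤ n → ∀ w, g a J w - lead k a J w ∈ filt k X W J.card)
    (l : L) {m : ℕ} (hm : m ≤ n) {v : Multiset X →₀ W} (hv : v ∈ filt k X W m) :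
    bilinExt b g l v ∈ filt k X W (m + 1) := by
  refine basis_induction b
    (S := (filt k X W (m + 1)).comap ((bilinExt b g).flip v)) (fun a => ?_) l
  refine filt_induction
    (S := (filt k X W (m + 1)).comap (bilinExt b g (b a))) (fun J hJ w => ?_) hv
  rw [Submodule.mem_comap, bilinExt_basis_single, ← sub_add_cancel (g a J w) (lead k a J w)]
  exact add_mem (filt_mono (by lia) (h a J (by lia) w))
    (filt_mono (by lia) (lead_mem_filt a J w))

end Extension

/-- Elements of `Y` lie above all elements of `X`. -/
def rank : X ⊕ Y → WithTop X
  | .inl x => x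
  | .inr _ => ⊤

/-- `p = (j, N)` splits off the least element `j` of `J`, and `j` lies below `a`. -/
def IsSplit (a : X ⊕ Y) (J : Multiset X) (p : X × Multiset X) : Prop :=
  J = p.1 ::ₘ p.2 ∧ (∀ i ∈ p.2, p.1 ≤ i) ∧ (p.1 : WithTop X) < rank a

lemma IsSplit.unique {a : X ⊕ Y} {J : Multiset X} {p q : X × Multiset X}
    (hp : IsSplit a J p) (hq : IsSplit a J q) : p = q := by
  obtain ⟨i, P⟩ := p
  obtain ⟨j, Q⟩ := q
  obtain ⟨hp, hp', -⟩ := hp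
  obtain ⟨hq, hq', -⟩ := hq
  simp only at *
  have hij : i = j := by
    apply le_antisymm
    · have : j ∈ i ::ₘ P := by rw [← hp, hq]; simp
      rcases Multiset.mem_cons.1 this with h | h
      exacts [h.ge, hp' j h]
    · have : i ∈ j ::ₘ Q := by rw [← hq, hp]; simp
      rcases Multiset.mem_cons.1 this with h | h
      exacts [h.ge, hq' i h]
  subst hij
  rw [hp, Multiset.cons_inj_right] at hq
  rw [hq]

lemma exists_cons_min {J : Multiset X} (hJ : J ≠ 0) :
    ∃ j N, J = j ::ₘ N ∧ ∀ i ∈ N, j ≤ i := by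
  obtain ⟨j, hj, hmin⟩ := Finset.exists_min_image J.toFinset id
    (by simpa [Finset.nonempty_iff_ne_empty] using hJ)
  refine ⟨j, J.erase j, (Multiset.cons_erase (by simpa using hj)).symm, fun i hi => ?_⟩
  exact hmin i (by simpa using Multiset.mem_of_mem_erase hi)

variable {L₁ : LieSubalgebra k L} (b : Basis (X ⊕ Y) k L) (b₁ : Basis Y k L₁)
  (ρ : L₁ →ₗ⁅k⁆ End k W)

/-- The action of a basis element on a monomial that need not be straightened. -/
def baseAct : X ⊕ Y → Multiset X → W →ₗ[k] (Multiset X →₀ W)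
  | .inl x, J => lsingle (x ::ₘ J)
  | .inr y, J => lsingle J ∘ₗ ρ (b₁ y)

open scoped Classical in
/-- The action of basis elements on monomials of cardinality at most `n`. -/
def actAux : ℕ → X ⊕ Y → Multiset X → W →ₗ[k] (Multiset X →₀ W)
  | 0 => baseAct b₁ ρ
  | n + 1 => fun a J =>
    if h : ∃ p, IsSplit a J p then
      lead k a J + bilinExt b (actAux n) (b (.inl h.choose.1)) ∘ₗ
          (actAux n a h.choose.2 - lead k a h.choose.2) +
        bilinExt b (actAux n) ⁅b a, b (.inl h.choose.1)⁆ ∘ₗ lsingle h.choose.2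
    else baseAct b₁ ρ a J

lemma actAux_succ_of_isSplit (n : ℕ) {a : X ⊕ Y} {J : Multiset X} {j : X} {N : Multiset X}
    (h : IsSplit a J (j, N)) :
    actAux b b₁ ρ (n + 1) a J = lead k a J + bilinExt b (actAux b b₁ ρ n) (b (.inl j)) ∘ₗ
        (actAux b b₁ ρ n a N - lead k a N) +
      bilinExt b (actAux b b₁ ρ n) ⁅b a, b (.inl j)⁆ ∘ₗ lsingle N := by
  have h' : ∃ p, IsSplit a J p := ⟨_, h⟩
  have e : h'.choose = (j, N) := h'.choose_spec.unique h
  simp only [actAux]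
  rw [dif_pos h', e]

lemma actAux_of_not_isSplit (n : ℕ) {a : X ⊕ Y} {J : Multiset X}
    (h : ¬ ∃ p, IsSplit a J p) : actAux b b₁ ρ n a J = baseAct b₁ ρ a J := by
  cases n with
  | zero => rfl
  | succ n => simp only [actAux, dif_neg h]

omit [LinearOrder X] in
lemma baseAct_sub_lead_mem_filt (a : X ⊕ Y) (J : Multiset X) (w : W) :
    baseAct b₁ ρ a J w - lead k a J w ∈ filt k X W J.card := by
  cases a with
  | inl x => simp [baseAct, lead]
  | inr y => simpa [baseAct, lead] using single_mem_filt (le_refl J.card) (ρ (b₁ y) w)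

lemma actAux_sub_lead_mem_filt (n : ℕ) : ∀ (a : X ⊕ Y) (J : Multiset X), J.card ≤ n →
    ∀ w, actAux b b₁ ρ n a J w - lead k a J w ∈ filt k X W J.card := by
  induction n with
  | zero => exact fun a J _ w => baseAct_sub_lead_mem_filt b₁ ρ a J w
  | succ n ih =>
    intro a J hJ w
    by_cases h : ∃ p, IsSplit a J p
    · obtain ⟨⟨j, N⟩, h⟩ := h
      have hc : J.card = N.card + 1 := by rw [h.1]; simp
      rw [actAux_succ_of_isSplit b b₁ ρ n h, hc]
      simp only [LinearMap.add_apply, LinearMap.comp_apply, LinearMap.sub_apply, lsingle_apply]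
      rw [add_assoc, add_sub_cancel_left]
      have hN : N.card ≤ n := by lia
      exact add_mem (bilinExt_mem_filt b ih _ hN (ih a N hN w))
        (bilinExt_mem_filt b ih _ hN (single_mem_filt le_rfl w))
    · rw [actAux_of_not_isSplit b b₁ ρ _ h]
      exact baseAct_sub_lead_mem_filt b₁ ρ a J w

lemma actAux_succ (n : ℕ) : ∀ (a : X ⊕ Y) (J : Multiset X), J.card ≤ n →
    actAux b b₁ ρ (n + 1) a J = actAux b b₁ ρ n a J := by
  induction n with
  | zero =>
    intro a J hJ
    rw [actAux_of_not_isSplit, actAux_of_not_isSplit] <;>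
    · rintro ⟨p, hp, -⟩
      simp [hp] at hJ
  | succ n ih =>
    intro a J hJ
    by_cases h : ∃ p, IsSplit a J p
    · obtain ⟨⟨j, N⟩, h⟩ := h
      have hc : J.card = N.card + 1 := by rw [h.1]; simp
      have hN : N.card ≤ n := by lia
      rw [actAux_succ_of_isSplit b b₁ ρ _ h, actAux_succ_of_isSplit b b₁ ρ _ h, ih a N hN]
      ext1 w
      simp only [LinearMap.add_apply, LinearMap.comp_apply, LinearMap.sub_apply, lsingle_apply]
      rw [bilinExt_congr b ih _ (filt_mono hN (actAux_sub_lead_mem_filt b b₁ ρ n a N hN w)),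
        bilinExt_congr b ih _ (single_mem_filt hN w)]
    · rw [actAux_of_not_isSplit b b₁ ρ _ h, actAux_of_not_isSplit b b₁ ρ _ h]

lemma actAux_eq {n : ℕ} (a : X ⊕ Y) (J : Multiset X) (h : J.card ≤ n) :
    actAux b b₁ ρ J.card a J = actAux b b₁ ρ n a J := by
  induction n, h using Nat.le_induction with
  | base => rfl
  | succ n hn ih => rw [ih, actAux_succ b b₁ ρ n a J hn]

/-- The action of `L` on the module induced from the `L₁`-module `W`. -/
def act : L →ₗ[k] End k (Multiset X →₀ W) := bilinExt b fun a J => actAux b b₁ ρ J.card a J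

lemma act_eq {n : ℕ} (l : L) {v : Multiset X →₀ W} (hv : v ∈ filt k X W n) :
    act b b₁ ρ l v = bilinExt b (actAux b b₁ ρ n) l v :=
  bilinExt_congr b (fun a J h => actAux_eq b b₁ ρ a J h) l hv

lemma act_sub_lead_mem_filt (a : X ⊕ Y) (J : Multiset X) (w : W) :
    act b b₁ ρ (b a) (single J w) - lead k a J w ∈ filt k X W J.card := by
  rw [act, bilinExt_basis_single]
  exact actAux_sub_lead_mem_filt b b₁ ρ _ a J le_rfl w

lemma act_single_of_le {x : X} {J : Multiset X} (h : ∀ i ∈ J, x ≤ i) (w : W) :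
    act b b₁ ρ (b (.inl x)) (single J w) = single (x ::ₘ J) w := by
  rw [act, bilinExt_basis_single, actAux_of_not_isSplit]
  · rfl
  · rintro ⟨⟨j, N⟩, rfl, -, hj⟩
    exact absurd (WithTop.coe_lt_coe.1 hj) (h j (by simp)).not_gt

lemma act_lead_of_le {j : X} {a : X ⊕ Y} {N : Multiset X} (h : ∀ i ∈ N, j ≤ i)
    (ha : (j : WithTop X) < rank a) (w : W) :
    act b b₁ ρ (b (.inl j)) (lead k a N w) = lead k a (j ::ₘ N) w := by
  cases a with
  | inl x =>
    have hx : j ≤ x := (WithTop.coe_lt_coe.1 ha).le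
    simp only [lead, lsingle_apply]
    rw [act_single_of_le, Multiset.cons_swap]
    simpa [hx] using h
  | inr y => simp [lead]

lemma act_single_cons {j : X} {a : X ⊕ Y} {N : Multiset X} (h : ∀ i ∈ N, j ≤ i)
    (ha : (j : WithTop X) < rank a) (w : W) :
    act b b₁ ρ (b a) (single (j ::ₘ N) w) =
      act b b₁ ρ (b (.inl j)) (act b b₁ ρ (b a) (single N w)) +
        act b b₁ ρ ⁅b a, b (.inl j)⁆ (single N w) := by
  have h1 : act b b₁ ρ (b a) (single N w) = actAux b b₁ ρ N.card a N w := by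
    rw [act, bilinExt_basis_single]
  conv_lhs => rw [act, bilinExt_basis_single, Multiset.card_cons,
    actAux_succ_of_isSplit b b₁ ρ _ ⟨rfl, h, ha⟩]
  simp only [LinearMap.add_apply, LinearMap.comp_apply, LinearMap.sub_apply, lsingle_apply]
  rw [← h1, ← act_eq b b₁ ρ _ (act_sub_lead_mem_filt b b₁ ρ a N w),
    ← act_eq b b₁ ρ _ (single_mem_filt le_rfl w), map_sub, act_lead_of_le b b₁ ρ h ha]
  abel

lemma act_single_zero (hb : ∀ y, b (.inr y) = b₁ y) (l : L₁) (w : W) :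
    act b b₁ ρ (l : L) (single 0 w) = single 0 (ρ l w) := by
  let f : L₁ →ₗ[k] (Multiset X →₀ W) :=
    (act b b₁ ρ).flip (single 0 w) ∘ₗ (L₁.toSubmodule.subtype)
  let g : L₁ →ₗ[k] (Multiset X →₀ W) :=
    lsingle 0 ∘ₗ (LinearMap.flip (ρ : L₁ →ₗ[k] End k W) w)
  have : f = g := b₁.ext fun y => by
    change act b b₁ ρ ((b₁ y : L₁) : L) (single 0 w) = single 0 (ρ (b₁ y) w)
    rw [← hb, act, bilinExt_basis_single, actAux_of_not_isSplit]
    · rfl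
    · rintro ⟨p, hp, -⟩
      exact Multiset.cons_ne_zero hp.symm
  exact LinearMap.congr_fun this l

/-- The set of vectors on which `l` and `l'` act compatibly with their bracket. -/
def compat (l l' : L) : Submodule k (Multiset X →₀ W) :=
  LinearMap.eqLocus (act b b₁ ρ ⁅l, l'⁆)
    (act b b₁ ρ l ∘ₗ act b b₁ ρ l' - act b b₁ ρ l' ∘ₗ act b b₁ ρ l)

lemma mem_compat {l l' : L} {v : Multiset X →₀ W} : v ∈ compat b b₁ ρ l l' ↔
    act b b₁ ρ ⁅l, l'⁆ v = act b b₁ ρ l (act b b₁ ρ l' v) - act b b₁ ρ l' (act b b₁ ρ l v) :=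
  Iff.rfl

lemma compat_symm {l l' : L} {v : Multiset X →₀ W} (h : v ∈ compat b b₁ ρ l l') :
    v ∈ compat b b₁ ρ l' l := by
  rw [mem_compat] at h ⊢
  rw [← lie_skew, map_neg, LinearMap.neg_apply, h, neg_sub]

lemma compat_self (l : L) (v : Multiset X →₀ W) : v ∈ compat b b₁ ρ l l := by
  simp [mem_compat]

lemma compat_of_basis {v : Multiset X →₀ W} (h : ∀ a c, v ∈ compat b b₁ ρ (b a) (b c))
    (l l' : L) : v ∈ compat b b₁ ρ l l' := by
  let S (l' : L) : Submodule k L :=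
    { carrier := {l | v ∈ compat b b₁ ρ l l'}
      add_mem' := fun {x y} hx hy => by
        simp only [Set.mem_ofPred_eq, mem_compat] at *
        simp only [add_lie, map_add, LinearMap.add_apply, hx, hy]
        abel
      zero_mem' := by simp [mem_compat]
      smul_mem' := fun r x hx => by
        simp only [Set.mem_ofPred_eq, mem_compat] at *
        simp only [smul_lie, map_smul, LinearMap.smul_apply, hx, smul_sub] }
  refine basis_induction b (S := S l') (fun a => compat_symm b b₁ ρ ?_) l
  exact basis_induction b (S := S (b a)) (fun c => h c a) l'

lemma compat_single_of_le {j : X} {a : X ⊕ Y} {N : Multiset X} (h : ∀ i ∈ N, j ≤ i)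
    (ha : (j : WithTop X) < rank a) (w : W) :
    single N w ∈ compat b b₁ ρ (b a) (b (.inl j)) := by
  rw [mem_compat, act_single_of_le b b₁ ρ h, act_single_cons b b₁ ρ h ha]
  abel

/-- The commutation step: the Jacobi identity propagates compatibility from `P` to `i ::ₘ P`. -/
lemma compat_single_cons {i : X} {a c : X ⊕ Y} {P : Multiset X} (h : ∀ j ∈ P, i ≤ j)
    (ha : (i : WithTop X) < rank a) (hc : (i : WithTop X) < rank c)
    (ih : ∀ l l', filt k X W P.card ≤ compat b b₁ ρ l l') (w : W) :
    single (i ::ₘ P) w ∈ compat b b₁ ρ (b a) (b c) := by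
  have hP : single P w ∈ filt k X W P.card := single_mem_filt le_rfl w
  have swap : ∀ a c : X ⊕ Y, (i : WithTop X) < rank a → (i : WithTop X) < rank c →
      act b b₁ ρ (b c) (single P w) ∈ compat b b₁ ρ (b a) (b (.inl i)) := by
    intro a c ha hc
    rw [← sub_add_cancel (act b b₁ ρ (b c) (single P w)) (lead k c P w)]
    refine add_mem (ih _ _ (act_sub_lead_mem_filt b b₁ ρ c P w)) ?_
    cases c with
    | inl x =>
      refine compat_single_of_le b b₁ ρ ?_ ha w
      simpa [(WithTop.coe_lt_coe.1 hc).le] using h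
    | inr y => exact Submodule.zero_mem _
  have s1 := swap a c ha hc
  have s2 := swap c a hc ha
  have e1 := ih (b a) (b c) hP
  have e2 := ih (b a) (b (.inl i)) hP
  have e3 := ih (b c) (b (.inl i)) hP
  have e4 := ih (b a) ⁅b c, b (.inl i)⁆ hP
  have e5 := ih (b c) ⁅b a, b (.inl i)⁆ hP
  have e6 := ih ⁅b a, b c⁆ (b (.inl i)) hP
  have jac : ⁅⁅b a, b c⁆, b (.inl i)⁆ = ⁅b a, ⁅b c, b (.inl i)⁆⁆ - ⁅b c, ⁅b a, b (.inl i)⁆⁆ :=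
    lie_lie _ _ _
  have e7 : act b b₁ ρ ⁅⁅b a, b c⁆, b (.inl i)⁆ (single P w) =
      act b b₁ ρ ⁅b a, ⁅b c, b (.inl i)⁆⁆ (single P w) -
        act b b₁ ρ ⁅b c, ⁅b a, b (.inl i)⁆⁆ (single P w) := by
    rw [jac, map_sub, LinearMap.sub_apply]
  rw [mem_compat] at s1 s2 e1 e2 e3 e4 e5 e6 ⊢
  rw [act_single_cons b b₁ ρ h ha, act_single_cons b b₁ ρ h hc, ← act_single_of_le b b₁ ρ h]
  have e1' := congrArg (act b b₁ ρ (b (.inl i))) e1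
  rw [map_sub] at e1'
  simp only [map_add]
  grind

lemma filt_le_compat (hb : ∀ y, b (.inr y) = b₁ y) (n : ℕ) :
    ∀ l l', filt k X W n ≤ compat b b₁ ρ l l' := by
  induction n using Nat.strong_induction_on with
  | _ n ih =>
  intro l l'
  refine filt_induction fun N hN w => compat_of_basis b b₁ ρ (fun a c => ?_) l l'
  wlog hac : rank c ≤ rank a generalizing a c
  · exact compat_symm b b₁ ρ (this c a (le_of_not_ge hac))
  have bot : ∀ {x : X}, c = .inl x → (∀ i ∈ N, x ≤ i) →
      single N w ∈ compat b b₁ ρ (b a) (b c) := by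
    rintro x rfl hx
    rcases hac.lt_or_eq with hlt | heq
    · exact compat_single_of_le b b₁ ρ hx hlt w
    · cases a with
      | inl x' =>
        obtain rfl : x = x' := WithTop.coe_injective heq
        exact compat_self b b₁ ρ _ _
      | inr y => exact absurd heq (WithTop.coe_ne_top)
  by_cases h0 : N = 0
  · subst h0
    cases c with
    | inl x => exact bot rfl (by simp)
    | inr y =>
      cases a with
      | inl x => exact absurd (top_le_iff.1 hac) (WithTop.coe_ne_top)
      | inr y' =>
        rw [mem_compat, hb, hb, ← LieSubalgebra.coe_bracket]
        simp only [act_single_zero b b₁ ρ hb, LieHom.map_lie]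
        rw [← single_sub]
        rfl
  · obtain ⟨i, P, rfl, hP⟩ := exists_cons_min h0
    by_cases hi : (i : WithTop X) < rank c
    · exact compat_single_cons b b₁ ρ hP (hi.trans_le hac) hi
        (ih _ (by simpa using hN)) w
    · cases c with
      | inl x =>
        have hx : x ≤ i := WithTop.coe_le_coe.1 (not_lt.1 hi)
        refine bot rfl fun j hj => ?_
        rcases Multiset.mem_cons.1 hj with rfl | hj
        exacts [hx, hx.trans (hP j hj)]
      | inr y => exact absurd (WithTop.coe_lt_top i) hi

/-- The induced module as a representation of `L`. -/
def actHom (hb : ∀ y, b (.inr y) = b₁ y) : L →ₗ⁅k⁆ End k (Multiset X →₀ W) :=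
  { act b b₁ ρ with
    map_lie' := fun {l l'} => by
      ext1 J
      ext1 w
      exact filt_le_compat b b₁ ρ hb J.card l l' (single_mem_filt le_rfl w) }

/-- A linear map out of the induced module that is compatible with adjoining a least factor
and with the action of `L₁` on `W` is equivariant. -/
lemma map_act {V : Type*} [AddCommGroup V] [Module k V] (σ : L →ₗ⁅k⁆ End k V)
    (ψ : (Multiset X →₀ W) →ₗ[k] V)
    (h₀ : ∀ y w, ψ (single 0 (ρ (b₁ y) w)) = σ (b (.inr y)) (ψ (single 0 w)))
    (hψ : ∀ x J w, (∀ i ∈ J, x ≤ i) →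
      ψ (single (x ::ₘ J) w) = σ (b (.inl x)) (ψ (single J w)))
    (hb : ∀ y, b (.inr y) = b₁ y) (n : ℕ) :
    ∀ l, ∀ v ∈ filt k X W n, ψ (act b b₁ ρ l v) = σ l (ψ v) := by
  induction n using Nat.strong_induction_on with
  | _ n ih =>
  intro l v hv
  refine basis_induction b (S := LinearMap.eqLocus (ψ ∘ₗ (act b b₁ ρ).flip v)
    ((σ : L →ₗ[k] End k V).flip (ψ v))) (fun a => ?_) l
  refine filt_induction (S := LinearMap.eqLocus (ψ ∘ₗ act b b₁ ρ (b a)) (σ (b a) ∘ₗ ψ))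
    (fun J hJ w => ?_) hv
  change ψ (act b b₁ ρ (b a) (single J w)) = σ (b a) (ψ (single J w))
  by_cases h0 : J = 0
  · subst h0
    cases a with
    | inl x => rw [act_single_of_le b b₁ ρ (by simp), hψ x 0 w (by simp)]
    | inr y => rw [hb, act_single_zero b b₁ ρ hb, h₀, hb]
  · obtain ⟨j, N, rfl, hN⟩ := exists_cons_min h0
    have hn : N.card < n := by simpa using hJ
    by_cases hj : (j : WithTop X) < rank a
    · have hl : ψ (act b b₁ ρ (b (.inl j)) (lead k a N w)) = σ (b (.inl j)) (ψ (lead k a N w)) := by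
        cases a with
        | inl x =>
          have hx : ∀ i ∈ x ::ₘ N, j ≤ i := by
            simpa [(WithTop.coe_lt_coe.1 hj).le] using hN
          simp only [lead, lsingle_apply]
          rw [act_single_of_le b b₁ ρ hx, hψ _ _ _ hx]
        | inr y => simp [lead]
      have hs := ih _ hn (b (.inl j)) _ (act_sub_lead_mem_filt b b₁ ρ a N w)
      simp only [map_sub, hl, sub_left_inj] at hs
      have hNf := single_mem_filt (k := k) (le_refl N.card) w
      rw [act_single_cons b b₁ ρ hN hj, map_add, hs, ih _ hn _ _ hNf, ih _ hn _ _ hNf,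
        LieHom.map_lie, hψ _ _ _ hN]
      simp [LieRing.of_associative_ring_bracket]
    · cases a with
      | inl x =>
        have hx : ∀ i ∈ j ::ₘ N, x ≤ i := by
          have hxj : x ≤ j := WithTop.coe_le_coe.1 (not_lt.1 hj)
          intro i hi
          rcases Multiset.mem_cons.1 hi with rfl | hi
          exacts [hxj, hxj.trans (hN i hi)]
        rw [act_single_of_le b b₁ ρ hx, hψ _ _ _ hx]
      | inr y => exact absurd (WithTop.coe_lt_top j) hj

end

noncomputable section Enveloping

open UniversalEnvelopingAlgebra MulOpposite

attribute [local instance] LieRing.ofAssociativeRing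

variable {k L : Type*} [Field k] [LieRing L] [LieAlgebra k L]

lemma enveloping_induction {p : UniversalEnvelopingAlgebra k L → Prop}
    (algebraMap : ∀ r, p (algebraMap k _ r)) (ι : ∀ l, p (ι k l))
    (add : ∀ x y, p x → p y → p (x + y)) (mul : ∀ x y, p x → p y → p (x * y))
    (u : UniversalEnvelopingAlgebra k L) : p u := by
  let S : Subalgebra k (UniversalEnvelopingAlgebra k L) :=
    { carrier := {x | p x}
      algebraMap_mem' := algebraMap
      add_mem' := fun {x y} hx hy => add x y hx hy
      mul_mem' := fun {x y} hx hy => mul x y hx hy }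
  let f : L →ₗ⁅k⁆ S :=
    { toFun := fun l => ⟨UniversalEnvelopingAlgebra.ι k l, ι l⟩
      map_add' := fun x y => Subtype.ext (by simp)
      map_smul' := fun r x => Subtype.ext (by simp)
      map_lie' := fun {x y} => Subtype.ext (by simp [LieRing.of_associative_ring_bracket]) }
  have h : S.val.comp (lift k f) = AlgHom.id k _ := by
    ext l
    simp only [LieHom.comp_apply, AlgHom.coe_toLieHom, AlgHom.comp_apply, lift_ι_apply]
    rfl
  have hu := DFunLike.congr_fun h u
  rw [AlgHom.comp_apply, AlgHom.id_apply] at hu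
  exact hu ▸ (lift k f u).2

/-- The canonical map `U(L₁) → U(L)`. -/
def envelopingIncl (L₁ : LieSubalgebra k L) :
    UniversalEnvelopingAlgebra k L₁ →ₐ[k] UniversalEnvelopingAlgebra k L :=
  lift k ((ι k).comp L₁.incl)

lemma envelopingIncl_ι (L₁ : LieSubalgebra k L) (y : L₁) :
    envelopingIncl L₁ (ι k y) = ι k (y : L) :=
  lift_ι_apply k _ y

/-- Multiplication of ordered monomials with elements of `U(L₁)`. -/
def monomialMul {X : Type*} [LinearOrder X] (L₁ : LieSubalgebra k L) (e : X → L) :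
    (Multiset X →₀ UniversalEnvelopingAlgebra k L₁) →ₗ[k] UniversalEnvelopingAlgebra k L :=
  Finsupp.lsum k fun J => LinearMap.mulLeft k ((J.sort (· ≤ ·)).map fun x => ι k (e x)).prod ∘ₗ
    (envelopingIncl L₁).toLinearMap

lemma monomialMul_single {X : Type*} [LinearOrder X] (L₁ : LieSubalgebra k L) (e : X → L)
    (J : Multiset X) (u : UniversalEnvelopingAlgebra k L₁) :
    monomialMul L₁ e (single J u) =
      ((J.sort (· ≤ ·)).map fun x => ι k (e x)).prod * envelopingIncl L₁ u := by
  simp [monomialMul]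

/-- `monomialMul` is a homomorphism of right `U(L₁)`-modules. -/
lemma monomialMul_mapRange {X : Type*} [LinearOrder X] (L₁ : LieSubalgebra k L) (e : X → L)
    (f : Multiset X →₀ UniversalEnvelopingAlgebra k L₁) (u : UniversalEnvelopingAlgebra k L₁) :
    monomialMul L₁ e (f.mapRange (· * u) (zero_mul u)) =
      monomialMul L₁ e f * envelopingIncl L₁ u := by
  induction f using Finsupp.induction_linear with
  | zero => simp
  | add f g hf hg =>
    rw [mapRange_add (f := (· * u)) (hf' := fun x y => add_mul x y u), map_add, map_add, hf, hg,
      add_mul]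
  | single J v => simp [monomialMul_single, mul_assoc, -ι_apply, -Finsupp.single_mul]

/-- The Poincaré–Birkhoff–Witt theorem relative to a Lie subalgebra. -/
theorem monomialMul_bijective {X Y : Type*} [LinearOrder X] {L₁ : LieSubalgebra k L}
    (b : Basis (X ⊕ Y) k L) (b₁ : Basis Y k L₁) (hb : ∀ y, b (.inr y) = b₁ y) :
    Function.Bijective (monomialMul L₁ (b ∘ Sum.inl)) := by
  set ψ := monomialMul L₁ (b ∘ Sum.inl) with hψ
  let ρ : L₁ →ₗ⁅k⁆ End k (UniversalEnvelopingAlgebra k L₁) :=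
    ((Algebra.lmul k (UniversalEnvelopingAlgebra k L₁)) : _ →ₗ⁅k⁆ _).comp (ι k)
  let σ : L →ₗ⁅k⁆ End k (UniversalEnvelopingAlgebra k L) :=
    ((Algebra.lmul k (UniversalEnvelopingAlgebra k L)) : _ →ₗ⁅k⁆ _).comp (ι k)
  have hρ : ∀ y u, ρ y u = ι k y * u := fun _ _ => rfl
  have hσ : ∀ y u, σ y u = ι k y * u := fun _ _ => rfl
  let Φ : UniversalEnvelopingAlgebra k L →ₐ[k]
      End k (Multiset X →₀ UniversalEnvelopingAlgebra k L₁) := lift k (actHom b b₁ ρ hb)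
  have hΦ : ∀ l v, Φ (ι k l) v = act b b₁ ρ l v := fun l v => by
    simp only [Φ, lift_ι_apply]
    rfl
  have hcons : ∀ x (J : Multiset X), (∀ i ∈ J, x ≤ i) →
      (x ::ₘ J).sort (· ≤ ·) = x :: J.sort (· ≤ ·) := fun x J h =>
    Multiset.sort_cons _ _ _ h
  have hequiv : ∀ l v, ψ (act b b₁ ρ l v) = ι k l * ψ v := by
    intro l v
    have hv : v ∈ filt k X _ (v.support.sup Multiset.card) := fun J hJ =>
      Finset.le_sup (f := Multiset.card) hJ
    refine map_act b b₁ ρ σ ψ (fun y w => ?_) (fun x J w h => ?_) hb _ l v hv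
    · simp [hψ, monomialMul_single, hρ, hσ, envelopingIncl_ι, hb, -ι_apply, -Finsupp.single_mul]
    · simp [hψ, monomialMul_single, hσ, hcons x J h, mul_assoc]
  have hΦψ : ∀ t v, ψ (Φ t v) = t * ψ v := by
    intro t
    induction t using enveloping_induction with
    | algebraMap r => simp [Algebra.algebraMap_eq_smul_one]
    | ι l => simpa only [hΦ] using hequiv l
    | add x y hx hy => simp [hx, hy, add_mul]
    | mul x y hx hy => simp [hx, hy, mul_assoc]
  have h1 : ψ (single 0 1) = 1 := by simp [hψ, monomialMul_single]
  have hU : ∀ u w, Φ (envelopingIncl L₁ u) (single 0 w) = single 0 (u * w) := by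
    intro u
    induction u using enveloping_induction with
    | algebraMap r => simp [Algebra.algebraMap_eq_smul_one]
    | ι l => intro w; rw [envelopingIncl_ι, hΦ, act_single_zero b b₁ ρ hb, hρ]
    | add x y hx hy => simp [hx, hy, add_mul]
    | mul x y hx hy => simp [hx, hy, mul_assoc, -Finsupp.single_mul]
  have hΦz : ∀ J u, Φ (ψ (single J u)) (single 0 1) = single J u := by
    intro J u
    rw [hψ, monomialMul_single, map_mul, End.mul_apply, hU, mul_one]
    induction hn : J.card using Nat.strong_induction_on generalizing J with
    | _ n ih =>
    by_cases h0 : J = 0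
    · simp [h0]
    · obtain ⟨j, N, rfl, hN⟩ := exists_cons_min h0
      rw [hcons j N hN, List.map_cons, List.prod_cons, map_mul, End.mul_apply,
        ih N.card (by simp [← hn]) N rfl, Function.comp_apply, hΦ, act_single_of_le b b₁ ρ hN]
  constructor
  · refine Function.LeftInverse.injective (g := fun t => Φ t (single 0 1)) fun v => ?_
    induction v using Finsupp.induction_linear with
    | zero => simp
    | add f g hf hg => simp only [map_add, LinearMap.add_apply] at *; rw [hf, hg]
    | single J u => exact hΦz J u
  · exact fun t => ⟨Φ t (single 0 1), by rw [hΦψ, h1, mul_one]⟩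

/-- `U(L)` is a free right module over `U(L₁)`, with basis the ordered monomials in a family
of elements of `L`. -/
theorem exists_bijective_monomialMul.{u, v} {k : Type u} {L : Type v} [Field k] [LieRing L]
    [LieAlgebra k L] (L₁ : LieSubalgebra k L) : ∃ (X : Type v) (_ : LinearOrder X) (e : X → L),
    Function.Bijective (monomialMul L₁ e) := by
  obtain ⟨C, hC⟩ := L₁.toSubmodule.exists_isCompl
  let bC := Basis.ofVectorSpace k C
  let b₁ : Basis _ k L₁ := Basis.ofVectorSpace k L₁
  let b := (bC.prod b₁).map (Submodule.prodEquivOfIsCompl C L₁.toSubmodule hC.symm)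
  obtain ⟨_, -⟩ := exists_wellFoundedLT (Basis.ofVectorSpaceIndex k C)
  exact ⟨_, _, _, monomialMul_bijective b b₁ fun y => by
    simp only [b, Basis.map_apply, Basis.prod_apply, Sum.elim_inr, Function.comp_apply,
      LinearMap.inr_apply]
    exact zero_add _⟩

variable (k L) in
/-- The principal anti-automorphism of the enveloping algebra. -/
def envelopingAnti :
    UniversalEnvelopingAlgebra k L →ₐ[k] (UniversalEnvelopingAlgebra k L)ᵐᵒᵖ :=
  lift k
    { toFun := fun x => op (-ι k x)
      map_add' := fun x y => by simp [add_comm]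
      map_smul' := fun r x => by simp
      map_lie' := fun {x y} => by
        simp [LieRing.of_associative_ring_bracket, ← op_mul, ← op_sub] }

lemma envelopingAnti_envelopingAnti (u : UniversalEnvelopingAlgebra k L) :
    unop (envelopingAnti k L (unop (envelopingAnti k L u))) = u := by
  have hι (l : L) : envelopingAnti k L (ι k l) = op (-ι k l) := lift_ι_apply k _ l
  induction u using enveloping_induction with
  | algebraMap r => simp
  | ι l => simp [hι, -ι_apply]
  | add x y hx hy => simp [hx, hy]
  | mul x y hx hy => simp [hx, hy]

end Enveloping

end RelativePBW

open RelativePBW in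
/-- if the universal enveloping algebra `U(L)` of a Lie algebra `L` is an
Ore domain, then so is the universal enveloping algebra `U(L₁)` of any Lie subalgebra
`L₁` of `L`. -/
theorem enveloping_algebra_of_subalgebra_is_ore
    (k : Type*) [Field k]
    (L : Type*) [LieRing L] [LieAlgebra k L]
    (L₁ : LieSubalgebra k L)
    -- `U(L)` is an Ore domain
    [IsDomain (UniversalEnvelopingAlgebra k L)]
    (horeL : ∀ a s : UniversalEnvelopingAlgebra k L, s ≠ 0 →
      ∃ t r : UniversalEnvelopingAlgebra k L, t ≠ 0 ∧ t * a = r * s)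
    (horeR : ∀ a s : UniversalEnvelopingAlgebra k L, s ≠ 0 →
      ∃ t r : UniversalEnvelopingAlgebra k L, t ≠ 0 ∧ a * t = s * r) :
    -- `U(L₁)` is an Ore domain
    IsDomain (UniversalEnvelopingAlgebra k ↥L₁) ∧
    (∀ a s : UniversalEnvelopingAlgebra k ↥L₁, s ≠ 0 →
      ∃ t r : UniversalEnvelopingAlgebra k ↥L₁, t ≠ 0 ∧ t * a = r * s) ∧
    (∀ a s : UniversalEnvelopingAlgebra k ↥L₁, s ≠ 0 →
      ∃ t r : UniversalEnvelopingAlgebra k ↥L₁, t ≠ 0 ∧ a * t = s * r) := by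
  obtain ⟨X, _, e, hinj, hsurj⟩ := exists_bijective_monomialMul L₁
  have hincl : Function.Injective (envelopingIncl L₁) := fun u v huv => by
    refine Finsupp.single_injective (0 : Multiset X) (hinj ?_)
    simpa [monomialMul_single] using huv
  have left : ∀ a s : UniversalEnvelopingAlgebra k ↥L₁, s ≠ 0 →
      ∃ t r : UniversalEnvelopingAlgebra k ↥L₁, t ≠ 0 ∧ t * a = r * s := by
    intro a s hs
    obtain ⟨t, r, ht, htr⟩ := horeL (envelopingIncl L₁ a) (envelopingIncl L₁ s)
      ((map_ne_zero_iff _ hincl).2 hs)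
    obtain ⟨f, rfl⟩ := hsurj t
    obtain ⟨g, rfl⟩ := hsurj r
    obtain ⟨J, hJ⟩ := DFunLike.ne_iff.1 (show f ≠ 0 by rintro rfl; simp at ht)
    rw [← monomialMul_mapRange, ← monomialMul_mapRange] at htr
    refine ⟨f J, g J, hJ, ?_⟩
    simpa using DFunLike.congr_fun (hinj htr) J
  refine ⟨hincl.isDomain (envelopingIncl L₁), left, fun a s hs => ?_⟩
  have hanti := envelopingAnti_envelopingAnti (k := k) (L := L₁)
  obtain ⟨t, r, ht, htr⟩ := left (envelopingAnti k L₁ a).unop (envelopingAnti k L₁ s).unop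
    (fun h => hs (by rw [← hanti s, h]; simp))
  refine ⟨(envelopingAnti k L₁ t).unop, (envelopingAnti k L₁ r).unop,
    fun h => ht (by rw [← hanti t, h]; simp), ?_⟩
  simpa [hanti] using congrArg (fun x => (envelopingAnti k L₁ x).unop) htr
end
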